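/- arXiv:math/0702504 — 2 statements merged into one kernel-verified Lean document; each statement's English description precedes it below -/
import Mathlib

section
/- If q is an element of a field k and m > 1 is an integer such that all Gaussian (q-)binomial coefficients [m choose k]_q vanish for 1 ≤ k < m, then q^m = 1 and, letting t be the multiplicative order of q, either m = t, or the characteristic of k is a prime p and m = t·p^s for some s ≥ 1. -/
/-- The Gaussian (q-)binomial coefficient `[m choose j]_q`, defined by the q-Pascal
recursion `[m choose j]_q = [m-1 choose j-1]_q + q^j [m-1 choose j]_q`,
with `[m choose 0]_q = 1` and `[m choose j]_q = 0` for `j > m`. -/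
noncomputable def qBinom {K : Type*} [Field K] (q : K) : ℕ → ℕ → K
  | _, 0 => 1
  | 0, _ + 1 => 0
  | m + 1, j + 1 => qBinom q m j + q ^ (j + 1) * qBinom q m (j + 1)

open Polynomial in
/-- The product `∏_{i < m} (1 + q^i X)`. -/
noncomputable def qProd {K : Type*} [Field K] (q : K) (m : ℕ) : K[X] :=
  ∏ i ∈ Finset.range m, (1 + C (q ^ i) * X)

section qProd

open Polynomial

variable {K : Type*} [Field K] (q : K)

theorem qProd_succ_eq_mul_comp (m : ℕ) :
    qProd q (m + 1) = (1 + X) * (qProd q m).comp (C q * X) := by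
  rw [qProd, qProd, Finset.prod_range_succ', prod_comp, mul_comm]
  congr 1
  · simp
  · refine Finset.prod_congr rfl fun i _ => ?_
    simp only [add_comp, one_comp, mul_comp, C_comp, X_comp, pow_succ, C_mul]
    ring

/-- The `q`-binomial theorem. -/
theorem coeff_qProd (m j : ℕ) :
    (qProd q m).coeff j = q ^ j.choose 2 * qBinom q m j := by
  induction m generalizing j with
  | zero => cases j <;> simp [qProd, qBinom, coeff_one]
  | succ m ih =>
    rw [qProd_succ_eq_mul_comp, add_mul, one_mul, coeff_add]
    cases j with
    | zero => simp [comp_C_mul_X_coeff, ih, qBinom]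
    | succ j =>
      rw [coeff_X_mul, comp_C_mul_X_coeff, comp_C_mul_X_coeff, ih, ih, qBinom,
        Nat.choose_succ_succ' j 1, Nat.choose_one_right]
      ring

theorem qBinom_eq_zero_of_lt {m j : ℕ} (h : m < j) : qBinom q m j = 0 := by
  induction m generalizing j with
  | zero => cases j with
    | zero => omega
    | succ j => simp [qBinom]
  | succ m ih => cases j with
    | zero => omega
    | succ j => simp [qBinom, ih (show m < j by omega), ih (show m < j + 1 by omega)]

theorem qBinom_self (m : ℕ) : qBinom q m m = 1 := by
  induction m with
  | zero => simp [qBinom]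
  | succ m ih => simp [qBinom, ih, qBinom_eq_zero_of_lt q (Nat.lt_succ_self m)]

theorem qBinom_one_right (m : ℕ) : qBinom q m 1 = ∑ i ∈ Finset.range m, q ^ i := by
  induction m with
  | zero => simp [qBinom]
  | succ m ih => simp [qBinom, ih, Finset.sum_range_succ', Finset.mul_sum, pow_succ', add_comm]

theorem qProd_comp_of_pow_eq_one {t : ℕ} (ht : q ^ t = 1) :
    (qProd q t).comp (C q * X) = qProd q t := by
  have hX : (1 + X : K[X]) ≠ 0 := by
    rw [add_comm]
    exact X_add_C_ne_zero 1
  apply mul_left_cancel₀ hX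
  rw [← qProd_succ_eq_mul_comp, qProd, Finset.prod_range_succ, ht, C_1, one_mul, mul_comm, qProd]

theorem qProd_orderOf (ht : 0 < orderOf q) :
    qProd q (orderOf q) = 1 + C (q ^ (orderOf q).choose 2) * X ^ orderOf q := by
  ext j
  rw [coeff_add, coeff_C_mul, coeff_X_pow, coeff_one]
  rcases Nat.eq_zero_or_pos j with rfl | hj
  · simp [coeff_qProd, qBinom, ht.ne]
  rcases lt_trichotomy j (orderOf q) with h | rfl | h
  · have hc := congrArg (coeff · j) (qProd_comp_of_pow_eq_one q (pow_orderOf_eq_one q))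
    simp only [comp_C_mul_X_coeff] at hc
    have hne : q ^ j ≠ 1 := pow_ne_one_of_lt_orderOf hj.ne' h
    rw [mul_right_eq_self₀] at hc
    simp [hc.resolve_left hne, hj.ne', h.ne]
  · simp [coeff_qProd, qBinom_self, hj.ne']
  · simp [coeff_qProd, qBinom_eq_zero_of_lt q h, hj.ne', h.ne']

theorem qProd_mul_of_pow_eq_one {t : ℕ} (ht : q ^ t = 1) (a : ℕ) :
    qProd q (t * a) = qProd q t ^ a := by
  induction a with
  | zero => simp [qProd]
  | succ a ih =>
    rw [pow_succ, ← ih, mul_add_one, qProd, Finset.prod_range_add]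
    simp [qProd, pow_add, pow_mul, ht]

theorem coeff_one_add_C_mul_X_pow_pow {t : ℕ} (ht : 0 < t) (e : K) (a c : ℕ) :
    ((1 + C e * X ^ t) ^ a).coeff (t * c) = a.choose c * e ^ c := by
  have h : (1 + C e * X ^ t) ^ a = expand K t (((1 + X) ^ a).comp (C e * X)) := by
    simp
  rw [h, coeff_expand_mul' ht, comp_C_mul_X_coeff, coeff_one_add_X_pow]

/-- A special case of the `q`-Lucas theorem. -/
theorem qBinom_orderOf_mul_eq_zero_iff (hq : q ≠ 0) (ht : 0 < orderOf q) (a c : ℕ) :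
    qBinom q (orderOf q * a) (orderOf q * c) = 0 ↔ (a.choose c : K) = 0 := by
  have h := coeff_qProd q (orderOf q * a) (orderOf q * c)
  rw [qProd_mul_of_pow_eq_one q (pow_orderOf_eq_one q), qProd_orderOf q ht,
    coeff_one_add_C_mul_X_pow_pow ht] at h
  have h₁ := congrArg (· = 0) h
  simpa [hq] using h₁.symm

theorem cast_choose_pow_mul_pow (p : ℕ) [Fact p.Prime] [CharP K p] (s b : ℕ) :
    (((p ^ s * b).choose (p ^ s) : ℕ) : K) = b := by
  have h := coeff_one_add_C_mul_X_pow_pow (pow_pos (Fact.out : p.Prime).pos s) (1 : K) b 1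
  rw [← coeff_one_add_X_pow, pow_mul, add_pow_char_pow]
  simpa using h

end qProd

/-- If `a > 1` and the inner binomial coefficients of `a` vanish in a field, then the field has
prime characteristic `p` and `a` is a power of `p`. -/
theorem exists_eq_prime_pow_of_choose_eq_zero (K : Type*) [Field K] {a : ℕ} (ha : 1 < a)
    (h : ∀ c, 1 ≤ c → c < a → (a.choose c : K) = 0) :
    ∃ p s : ℕ, p.Prime ∧ CharP K p ∧ 1 ≤ s ∧ a = p ^ s := by
  have ha0 : (a : K) = 0 := by simpa using h 1 le_rfl ha
  obtain ⟨p, hp⟩ := CharP.exists K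
  have hpa : p ∣ a := (CharP.cast_eq_zero_iff K p a).1 ha0
  have hprime : p.Prime := (CharP.char_is_prime_or_zero K p).resolve_right <| by
    rintro rfl
    rw [zero_dvd_iff] at hpa
    omega
  have : Fact p.Prime := ⟨hprime⟩
  obtain ⟨s, b, hb, hab⟩ := Nat.exists_eq_pow_mul_and_not_dvd (by omega : a ≠ 0) p hprime.ne_one
  have hb0 : b ≠ 0 := by
    rintro rfl
    simp at hb
  have hpos : 0 < p ^ s := pow_pos hprime.pos s
  have hb1 : b = 1 := by
    by_contra hne
    have hlt : p ^ s < a := by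
      rw [hab]
      exact lt_mul_of_one_lt_right hpos (by omega)
    have hc := h (p ^ s) hpos hlt
    rw [hab, cast_choose_pow_mul_pow, CharP.cast_eq_zero_iff K p] at hc
    exact hb hc
  subst hb1
  rw [mul_one] at hab
  refine ⟨p, s, hprime, hp, Nat.one_le_iff_ne_zero.2 ?_, hab⟩
  rintro rfl
  simp at hab
  omega

/-- If all Gaussian binomial coefficients `[m choose j]_q` vanish for `1 ≤ j < m`
(with `m > 1`), then `q^m = 1` and, for `t` the multiplicative order of `q`,
either `m = t`, or `char K` is a prime `p` and `m = t·p^s` for some `s ≥ 1`. -/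
theorem vanishing_qBinom_implies_order {K : Type*} [Field K] (q : K) (hq : q ≠ 0)
    (m : ℕ) (hm : 1 < m) (hvanish : ∀ j, 1 ≤ j → j < m → qBinom q m j = 0) :
    q ^ m = 1 ∧
      (m = orderOf q ∨
        ∃ p s : ℕ, p.Prime ∧ CharP K p ∧ 1 ≤ s ∧ m = orderOf q * p ^ s) := by
  have hqm : q ^ m = 1 := by
    rw [← sub_eq_zero, ← geom_sum_mul, ← qBinom_one_right, hvanish 1 le_rfl hm, zero_mul]
  refine ⟨hqm, ?_⟩
  have ht : 0 < orderOf q := orderOf_pos_iff.2 (isOfFinOrder_iff_pow_eq_one.2 ⟨m, by omega, hqm⟩)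
  obtain ⟨a, ha⟩ := orderOf_dvd_of_pow_eq_one hqm
  have hchoose : ∀ c, 1 ≤ c → c < a → (a.choose c : K) = 0 := fun c hc hca => by
    rw [← qBinom_orderOf_mul_eq_zero_iff q hq ht, ← ha]
    exact hvanish _ (Nat.mul_pos ht hc) (ha ▸ Nat.mul_lt_mul_of_pos_left hca ht)
  rcases Nat.lt_or_ge 1 a with h1 | h1
  · obtain ⟨p, s, hp, hchar, hs, rfl⟩ := exists_eq_prime_pow_of_choose_eq_zero K h1 hchoose
    exact Or.inr ⟨p, s, hp, hchar, hs, ha⟩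
  · left
    interval_cases a
    · omega
    · simpa using ha
end

section
/- Main theorem: Let H be a character Hopf algebra, i.e. a Hopf algebra whose group G of group-like elements is commutative and which is generated over k[G] by skew-primitive semi-invariants. Then every right coideal subalgebra U of H containing k[G] has a PBW-basis over k[G] which can be extended to a PBW-basis of H over k[G]: there is a set P of PBW-generators of H over k[G] and a subset T ⊆ P such that an element of H lies in U if and only if its PBW-decomposition involves only generators from T; in particular T is a set of PBW-generators of U over k[G]. -/
open scoped TensorProduct

/-- A group-like element: `Δ g = g ⊗ g` and `ε g = 1`. -/
def IsGrpLike (k : Type*) {H : Type*} [CommRing k] [Ring H] [Bialgebra k H]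
    (g : H) : Prop :=
  Coalgebra.counit (R := k) g = 1 ∧ Coalgebra.comul (R := k) g = g ⊗ₜ[k] g

/-- The product `v₁^{n₁} ⋯ v_k^{n_k}` associated to an exponent function `f`,
factors in increasing order. -/
noncomputable def pbwProd {S V : Type*} [Monoid S] [LinearOrder V]
    (emb : V → S) (f : V →₀ ℕ) : S :=
  ((f.support.sort (· ≤ ·)).map fun v => emb v ^ f v).prod

/-- Exponents strictly below the height function. -/
def Restricted {V : Type*} (h : V → ℕ∞) (f : V →₀ ℕ) : Prop :=
  ∀ v, (f v : ℕ∞) < h v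

/-- The family of monotone restricted products `a_j · v₁^{n₁} ⋯ v_k^{n_k}`. -/
noncomputable def pbwFam {S J V : Type*} [Monoid S] [LinearOrder V]
    (a : J → S) (emb : V → S) (h : V → ℕ∞) :
    J × {f : V →₀ ℕ // Restricted h f} → S :=
  fun p => a p.1 * pbwProd emb p.2.1

/-- `V` is a set of PBW-generators of `S` over the subspace with basis `a : J → S`:
the monotone restricted products form a `k`-basis of `S`. -/
def IsPBWBasis (k : Type*) {S J V : Type*} [Field k] [Ring S] [Algebra k S]
    [LinearOrder V] (a : J → S) (emb : V → S) (h : V → ℕ∞) : Prop :=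
  LinearIndependent k (pbwFam a emb h) ∧
    Submodule.span k (Set.range (pbwFam a emb h)) = ⊤

/-- The subspace `P ⊗ Q` of `H ⊗ H` spanned by the tensors `a ⊗ b`. -/
def tsub (k : Type*) {H : Type*} [CommRing k] [Ring H] [Algebra k H]
    (P Q : Submodule k H) : Submodule k (TensorProduct k H H) :=
  Submodule.span k {z | ∃ a ∈ P, ∃ b ∈ Q, z = a ⊗ₜ[k] b}

namespace CharHopf

section Words

variable {α : Type*}

/-- `Sh u v z` : the word `z` is a shuffle of the words `u` and `v`. -/
inductive Sh : List α → List α → List α → Prop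
  | nil : Sh [] [] []
  | left {a u v z} : Sh u v z → Sh (a :: u) v (a :: z)
  | right {a u v z} : Sh u v z → Sh u (a :: v) (a :: z)

/-- `Early b t v z` : the word `z` is a shuffle of `t ++ b` and `v` in which the first letter
of `v` is read before `t` is exhausted. -/
inductive Early (b : List α) : List α → List α → List α → Prop
  | here {a t v z} : t ≠ [] → Sh (t ++ b) v z → Early b t (a :: v) (a :: z)
  | left {x t v z} : Early b t v z → Early b (x :: t) v (x :: z)

theorem Sh.nil_left : ∀ v : List α, Sh [] v v
  | [] => .nil
  | _ :: v => .right (Sh.nil_left v)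

theorem Sh.append : ∀ u v : List α, Sh u v (u ++ v)
  | [], v => .nil_left v
  | _ :: u, v => .left (Sh.append u v)

theorem Sh.symm {u v z : List α} (h : Sh u v z) : Sh v u z := by
  induction h with
  | nil => exact .nil
  | left _ ih => exact .right ih
  | right _ ih => exact .left ih

theorem Sh.length_eq {u v z : List α} (h : Sh u v z) : z.length = u.length + v.length := by
  induction h with
  | nil => rfl
  | left _ ih => simp [ih]; omega
  | right _ ih => simp [ih]; omega

theorem Sh.eq_of_nil_left {v z : List α} (h : Sh [] v z) : z = v := by
  induction v generalizing z with
  | nil => cases h; rfl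
  | cons a v ih => cases h with | right h => rw [ih h]

theorem Sh.eq_of_nil_right {u z : List α} (h : Sh u [] z) : z = u :=
  h.symm.eq_of_nil_left

variable [LinearOrder α]

theorem lt_append_right (a : List α) {r : List α} (hr : r ≠ []) : a < a ++ r := by
  induction a with
  | nil =>
    cases r with
    | nil => exact absurd rfl hr
    | cons => simp
  | cons x a ih => simpa [List.cons_lt_cons_iff] using ih

theorem le_append_right (a r : List α) : a ≤ a ++ r := by
  rcases eq_or_ne r [] with rfl | hr
  · simp
  · exact (lt_append_right a hr).le

theorem append_lt_append_left {r s : List α} (a : List α) (h : r < s) : a ++ r < a ++ s := by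
  induction a with
  | nil => exact h
  | cons x a ih => simpa [List.cons_lt_cons_iff] using ih

theorem prefix_or_append_lt {a b : List α} (h : a < b) :
    (∃ r, r ≠ [] ∧ b = a ++ r) ∨ ∀ x y, a ++ x < b ++ y := by
  induction a generalizing b with
  | nil => exact .inl ⟨b, by rintro rfl; simp at h, rfl⟩
  | cons c a ih =>
    cases b with
    | nil => simp at h
    | cons d b =>
      rcases List.cons_lt_cons_iff.1 h with h1 | ⟨rfl, h1⟩
      · exact .inr fun x y => List.cons_lt_cons_iff.2 (.inl h1)
      · rcases ih h1 with ⟨r, hr, rfl⟩ | h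
        · exact .inl ⟨r, hr, rfl⟩
        · exact .inr fun x y => List.cons_lt_cons_iff.2 (.inr ⟨rfl, h x y⟩)

theorem append_lt_append_of_length_le {a b : List α} (h : a < b) (hl : b.length ≤ a.length)
    (x y : List α) : a ++ x < b ++ y := by
  rcases prefix_or_append_lt h with ⟨r, hr, rfl⟩ | h
  · have := List.length_pos_iff.2 hr
    rw [List.length_append] at hl
    omega
  · exact h x y

/-- Replacing two words by larger ones of the same lengths enlarges some shuffle. -/
theorem Sh.exists_ge {u v z : List α} (h : Sh u v z) {a b : List α} (ha : u.length = a.length)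
    (hb : v.length = b.length) (hua : u ≤ a) (hvb : v ≤ b) :
    ∃ w, Sh a b w ∧ z ≤ w ∧ (z = w → u = a ∧ v = b) := by
  induction h generalizing a b with
  | nil =>
    obtain rfl := List.length_eq_zero_iff.1 ha.symm
    obtain rfl := List.length_eq_zero_iff.1 hb.symm
    exact ⟨[], .nil, le_rfl, fun _ => ⟨rfl, rfl⟩⟩
  | @left x u v z h ih =>
    cases a with
    | nil => simp at ha
    | cons y a =>
      rcases hua.lt_or_eq with hlt | heq
      · rcases List.cons_lt_cons_iff.1 hlt with h1 | ⟨rfl, h1⟩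
        · have : x :: z < y :: (a ++ b) := List.cons_lt_cons_iff.2 (.inl h1)
          exact ⟨_, .left (.append a b), this.le, fun e => absurd e this.ne⟩
        · obtain ⟨w, hw, hzw, he⟩ := ih (by simpa using ha) hb h1.le hvb
          refine ⟨x :: w, .left hw, List.cons_le_cons _ hzw, fun e => ?_⟩
          have := he (by simpa using e)
          exact ⟨by rw [this.1], this.2⟩
      · obtain ⟨rfl, rfl⟩ := List.cons_eq_cons.1 heq
        obtain ⟨w, hw, hzw, he⟩ := ih rfl hb le_rfl hvb
        exact ⟨x :: w, .left hw, List.cons_le_cons _ hzw,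
          fun e => ⟨rfl, (he (by simpa using e)).2⟩⟩
  | @right x u v z h ih =>
    cases b with
    | nil => simp at hb
    | cons y b =>
      rcases hvb.lt_or_eq with hlt | heq
      · rcases List.cons_lt_cons_iff.1 hlt with h1 | ⟨rfl, h1⟩
        · have : x :: z < y :: (a ++ b) := List.cons_lt_cons_iff.2 (.inl h1)
          exact ⟨_, .right (.append a b), this.le, fun e => absurd e this.ne⟩
        · obtain ⟨w, hw, hzw, he⟩ := ih ha (by simpa using hb) hua h1.le
          refine ⟨x :: w, .right hw, List.cons_le_cons _ hzw, fun e => ?_⟩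
          have := he (by simpa using e)
          exact ⟨this.1, by rw [this.2]⟩
      · obtain ⟨rfl, rfl⟩ := List.cons_eq_cons.1 heq
        obtain ⟨w, hw, hzw, he⟩ := ih ha rfl hua le_rfl
        exact ⟨x :: w, .right hw, List.cons_le_cons _ hzw,
          fun e => ⟨(he (by simpa using e)).1, rfl⟩⟩

/-- Moving a nonempty prefix `p` from the larger word `t` to the smaller word `v` does not
decrease the largest shuffle. -/
theorem Sh.exchange {u v z : List α} (h : Sh u v z) {t b p : List α} (hu : u = p ++ (t ++ b))
    (hp : p ≠ []) (hvt : v < t) :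
    ∃ z', Sh (t ++ b) (p ++ v) z' ∧ (z < z' ∨ z ≤ z' ∧ Early b t (p ++ v) z') := by
  induction h generalizing t p with
  | nil => simp at hu; exact absurd hu.1 hp
  | @left a u v z h ih =>
    have ht : t ≠ [] := by rintro rfl; simp at hvt
    cases p with
    | nil => exact absurd rfl hp
    | cons c p =>
      obtain ⟨rfl, rfl⟩ := List.cons_eq_cons.1 hu
      rcases eq_or_ne p [] with rfl | hp'
      · exact ⟨a :: z, .right h, .inr ⟨le_rfl, .here ht h⟩⟩
      · obtain ⟨z', hz', h'⟩ := ih rfl hp' hvt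
        refine ⟨a :: z', .right hz', .inr ⟨List.cons_le_cons _ ?_, .here ht hz'⟩⟩
        rcases h' with h' | h'
        exacts [h'.le, h'.1]
  | @right a u v z h ih =>
    cases t with
    | nil => simp at hvt
    | cons c t =>
      rcases List.cons_lt_cons_iff.1 hvt with hac | ⟨rfl, hvt'⟩
      · exact ⟨c :: (t ++ b ++ (p ++ a :: v)), .left (.append _ _),
          .inl (List.cons_lt_cons_iff.2 (.inl hac))⟩
      · obtain ⟨z', hz', h'⟩ := ih (t := t) (p := p ++ [a]) (by simp [hu]) (by simp) hvt'
        rw [List.append_assoc, List.singleton_append] at hz' h'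
        refine ⟨a :: z', .left hz', ?_⟩
        rcases h' with h' | ⟨h1, h2⟩
        · exact .inl (List.cons_lt_cons_iff.2 (.inr ⟨rfl, h'⟩))
        · exact .inr ⟨List.cons_le_cons _ h1, .left h2⟩

/-- If every nonempty suffix of `t` is larger than `v`, then in a largest shuffle of `t ++ b`
and `v` the word `t` is read first. -/
theorem Sh.le_append {t b v y : List α} (hy : ∀ z, Sh b v z → z ≤ y)
    (ht : ∀ t₁ t₂, t = t₁ ++ t₂ → t₂ ≠ [] → v < t₂) (z : List α) :
    (Sh (t ++ b) v z → z ≤ t ++ y) ∧ (Early b t v z → z < t ++ y) := by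
  induction t generalizing z with
  | nil => exact ⟨hy z, fun h => by cases h; contradiction⟩
  | cons x t ih =>
    have ih := fun z => ih (fun t₁ t₂ h => ht (x :: t₁) t₂ (by simp [h])) z
    have key : ∀ a v' z', v = a :: v' → Sh (x :: t ++ b) v' z' → a :: z' < x :: t ++ y := by
      rintro a v' z' rfl h
      rcases List.cons_lt_cons_iff.1 (ht [] (x :: t) rfl (by simp)) with h1 | ⟨rfl, h1⟩
      · exact List.cons_lt_cons_iff.2 (.inl h1)
      · refine List.cons_lt_cons_iff.2 (.inr ⟨rfl, ?_⟩)
        obtain ⟨z₂, hz₂, h2⟩ := h.exchange (t := t) (b := b) (p := [a]) (by simp) (by simp) h1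
        rcases h2 with h2 | ⟨h2, h3⟩
        · exact h2.trans_le ((ih z₂).1 hz₂)
        · exact h2.trans_lt ((ih z₂).2 h3)
    constructor
    · intro h
      cases h with
      | left h => exact List.cons_le_cons _ ((ih _).1 h)
      | right h => exact (key _ _ _ rfl h).le
    · intro h
      cases h with
      | here _ h => exact key _ _ _ rfl h
      | left h => exact List.cons_lt_cons_iff.2 (.inr ⟨rfl, (ih _).2 h⟩)

/-- The power `l ⋯ l` of a word. -/
def lpow (l : List α) (n : ℕ) : List α := (List.replicate n l).flatten

omit [LinearOrder α] in
theorem lpow_zero (l : List α) : lpow l 0 = [] := rfl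

omit [LinearOrder α] in
theorem lpow_succ (l : List α) (n : ℕ) : lpow l (n + 1) = l ++ lpow l n := by
  simp [lpow, List.replicate_succ]

omit [LinearOrder α] in
theorem lpow_add (l : List α) (m n : ℕ) : lpow l (m + n) = lpow l m ++ lpow l n := by
  rw [lpow, List.replicate_add, List.flatten_append]; rfl

omit [LinearOrder α] in
theorem lpow_one (l : List α) : lpow l 1 = l := by simp [lpow]

omit [LinearOrder α] in
theorem lpow_mul (l : List α) (m n : ℕ) : lpow l (m * n) = lpow (lpow l m) n := by
  induction n with
  | zero => rfl
  | succ n ih => rw [mul_add, mul_one, add_comm, lpow_add, lpow_succ, ih]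

/-- Lyndon words: nonempty words smaller than all their proper nonempty suffixes. -/
def IsLyndon (l : List α) : Prop :=
  l ≠ [] ∧ ∀ a b, l = a ++ b → a ≠ [] → b ≠ [] → l < b

theorem IsLyndon.singleton (a : α) : IsLyndon [a] := by
  refine ⟨by simp, fun u v h hu hv => ?_⟩
  have := congrArg List.length h
  have := List.length_pos_iff.2 hu
  have := List.length_pos_iff.2 hv
  simp at *
  omega

theorem IsLyndon.le_suffix_lpow {l : List α} (hl : IsLyndon l) {n : ℕ} {t₁ t₂ : List α}
    (h : lpow l n = t₁ ++ t₂) (ht : t₂ ≠ []) : l ≤ t₂ := by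
  induction n generalizing t₁ with
  | zero => simp [lpow_zero, ht] at h
  | succ n ih =>
    rw [lpow_succ, List.append_eq_append_iff] at h
    rcases h with ⟨c, rfl, h⟩ | ⟨c, h, rfl⟩
    · exact ih h
    · rcases eq_or_ne c [] with rfl | hc
      · exact ih (t₁ := []) (by simp)
      · rcases eq_or_ne t₁ [] with rfl | ht₁
        · rw [List.nil_append] at h
          exact h ▸ le_append_right _ _
        · exact (hl.2 _ _ h ht₁ hc).le.trans (le_append_right _ _)

theorem IsLyndon.flatten_lt {l : List α} (hl : IsLyndon l) {L : List (List α)}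
    (hL : ∀ m ∈ L, m < l) : L.flatten < l := by
  induction L with
  | nil => simpa using (lt_append_right [] hl.1)
  | cons m L ih =>
    have hm : m < l := hL m (by simp)
    have ih := ih fun m' hm' => hL m' (by simp [hm'])
    rcases prefix_or_append_lt hm with ⟨r, hr, h⟩ | h
    · rcases eq_or_ne m [] with rfl | hm0
      · simpa using ih
      · have := append_lt_append_left m (ih.trans (hl.2 _ _ h hm0 hr))
        rwa [← h] at this
    · simpa using h L.flatten []

theorem IsLyndon.append {l m : List α} (hl : IsLyndon l) (hm : IsLyndon m) (h : l < m) :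
    IsLyndon (l ++ m) := by
  have hlm : l ++ m < m := by
    rcases prefix_or_append_lt h with ⟨r, hr, e⟩ | h'
    · have := append_lt_append_left l (hm.2 _ _ e hl.1 hr)
      rwa [← e] at this
    · simpa using h' m []
  refine ⟨by simp [hl.1], fun a b e ha hb => ?_⟩
  rw [List.append_eq_append_iff] at e
  rcases e with ⟨c, rfl, e⟩ | ⟨c, e, rfl⟩
  · rcases eq_or_ne c [] with rfl | hc
    · rw [List.nil_append] at e
      exact e ▸ hlm
    · exact hlm.trans (hm.2 _ _ e hc hb)
  · rcases eq_or_ne c [] with rfl | hc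
    · exact hlm
    · refine append_lt_append_of_length_le (hl.2 _ _ e ha hc) ?_ _ _
      simp [e]

/-- A nonincreasing list of Lyndon words. -/
def LyndonList (L : List (List α)) : Prop :=
  (∀ l ∈ L, IsLyndon l) ∧ L.Pairwise (· ≥ ·)

theorem LyndonList.exists_cons {L : List (List α)} (hL : LyndonList L) {l : List α}
    (hl : IsLyndon l) : ∃ L', LyndonList L' ∧ L'.flatten = l ++ L.flatten := by
  induction L generalizing l with
  | nil => exact ⟨[l], ⟨by simpa, by simp⟩, rfl⟩
  | cons m L ih =>
    have hm := hL.1 m (by simp)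
    have hp := List.pairwise_cons.1 hL.2
    rcases lt_or_ge l m with h | h
    · obtain ⟨L', h1, h2⟩ := ih ⟨fun x hx => hL.1 x (by simp [hx]), hp.2⟩ (hl.append hm h)
      exact ⟨L', h1, by simp [h2]⟩
    · refine ⟨l :: m :: L, ⟨?_, ?_⟩, rfl⟩
      · intro x hx
        rcases List.mem_cons.1 hx with rfl | hx
        exacts [hl, hL.1 x hx]
      · refine List.pairwise_cons.2 ⟨fun x hx => ?_, hL.2⟩
        rcases List.mem_cons.1 hx with rfl | hx
        exacts [h, (hp.1 x hx).trans h]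

theorem exists_lyndonList (w : List α) : ∃ L, LyndonList L ∧ L.flatten = w := by
  induction w with
  | nil => exact ⟨[], ⟨by simp, by simp⟩, rfl⟩
  | cons a w ih =>
    obtain ⟨L, hL, rfl⟩ := ih
    exact hL.exists_cons (.singleton a)

/-- A nonincreasing list of Lyndon words starts with a block of equal words followed by
smaller words. -/
theorem LyndonList.induction {P : List (List α) → Prop} (nil : P [])
    (block : ∀ l n L, IsLyndon l → 0 < n → LyndonList L → (∀ m ∈ L, m < l) → P L →
      P (List.replicate n l ++ L)) {L : List (List α)} (hL : LyndonList L) : P L := by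
  suffices H : ∀ L : List (List α), LyndonList L → P L ∧ ∀ l, IsLyndon l → (∀ m ∈ L, m ≤ l) →
      ∃ n L', L = List.replicate n l ++ L' ∧ LyndonList L' ∧ (∀ m ∈ L', m < l) ∧ P L' from
    (H L hL).1
  clear hL L
  intro L
  induction L with
  | nil =>
    exact fun h => ⟨nil, fun l _ _ => ⟨0, [], rfl, h, fun _ hm => absurd hm List.not_mem_nil, nil⟩⟩
  | cons m L ih =>
    intro hL
    have hm := hL.1 m (by simp)
    have hp := List.pairwise_cons.1 hL.2
    obtain ⟨h1, h2⟩ := ih ⟨fun x hx => hL.1 x (by simp [hx]), hp.2⟩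
    obtain ⟨n, L', rfl, hL', hlt, hP⟩ := h2 m hm hp.1
    have hPL : P (m :: (List.replicate n m ++ L')) := by
      have := block m (n + 1) L' hm n.succ_pos hL' hlt hP
      rwa [List.replicate_succ, List.cons_append] at this
    refine ⟨hPL, fun l hl hle => ?_⟩
    rcases (hle m (by simp)).lt_or_eq with hml | rfl
    · refine ⟨0, _, rfl, hL, fun x hx => ?_, hPL⟩
      rcases List.mem_cons.1 hx with rfl | hx
      exacts [hml, (hp.1 x hx).trans_lt hml]
    · exact ⟨n + 1, L', by simp [List.replicate_succ], hL', hlt, hP⟩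

theorem LyndonList.eq_of_flatten_eq {L M : List (List α)} (hL : LyndonList L)
    (hM : LyndonList M) (h : L.flatten = M.flatten) : L = M := by
  have aux : ∀ {l : List α} {L : List (List α)} {m : List α} {M : List (List α)},
      LyndonList (l :: L) → LyndonList (m :: M) →
      (l :: L).flatten = (m :: M).flatten → m ≤ l := by
    intro l L m M hL hM h
    by_contra! hlt
    have hm := hM.1 m (by simp)
    have : (l :: L).flatten < m := hm.flatten_lt fun x hx => by
      rcases List.mem_cons.1 hx with rfl | hx
      exacts [hlt, ((List.pairwise_cons.1 hL.2).1 x hx).trans_lt hlt]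
    rw [h, List.flatten_cons] at this
    exact absurd this (not_lt.2 (le_append_right _ _))
  have aux' : ∀ {l : List α} {L : List (List α)}, LyndonList (l :: L) → (l :: L).flatten ≠ [] := by
    intro l L hL
    simp [(hL.1 l (by simp)).1]
  induction L generalizing M with
  | nil =>
    cases M with
    | nil => rfl
    | cons m M => exact absurd h.symm (aux' hM)
  | cons l L ih =>
    cases M with
    | nil => exact absurd h (aux' hL)
    | cons m M =>
      obtain rfl := le_antisymm (aux hM hL h.symm) (aux hL hM h)
      rw [ih ⟨fun x hx => hL.1 x (by simp [hx]), (List.pairwise_cons.1 hL.2).2⟩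
        ⟨fun x hx => hM.1 x (by simp [hx]), (List.pairwise_cons.1 hM.2).2⟩ (by simpa using h)]

theorem IsLyndon.lt_suffix {l : List α} (hl : IsLyndon l) {v : List α} (hv : v < l) (n : ℕ)
    (t₁ t₂ : List α) (h : lpow l n = t₁ ++ t₂) (ht : t₂ ≠ []) : v < t₂ :=
  hv.trans_le (hl.le_suffix_lpow h ht)

theorem IsLyndon.lpow_lt_suffix {l : List α} (hl : IsLyndon l) {x : α} {t : List α}
    (e : l = x :: t) (n : ℕ) (t₁ t₂ : List α) (h : t = t₁ ++ t₂) (ht : t₂ ≠ []) :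
    lpow l n < t₂ := by
  have h1 : l < t₂ := hl.2 (x :: t₁) t₂ (by simp [e, h]) (by simp) ht
  cases n with
  | zero => exact lt_append_right [] ht
  | succ n =>
    rw [lpow_succ]
    simpa using append_lt_append_of_length_le h1 (by simp [e, h]; omega) (lpow l n) []

/-- The largest shuffle of a power of a Lyndon word and a smaller word. -/
theorem IsLyndon.sh_lpow_le {l : List α} (hl : IsLyndon l) {v : List α} (hv : v < l) (n : ℕ)
    {z : List α} (h : Sh (lpow l n) v z) : z ≤ lpow l n ++ v :=
  (Sh.le_append (b := []) (fun _ hz => hz.eq_of_nil_left.le) (hl.lt_suffix hv n) z).1 (by simpa)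

/-- The largest shuffle of two powers of a Lyndon word. -/
theorem IsLyndon.sh_lpow_lpow_le {l : List α} (hl : IsLyndon l) (m n : ℕ)
    {z : List α} (h : Sh (lpow l m) (lpow l n) z) : z ≤ lpow l (m + n) := by
  obtain ⟨x, t, e⟩ := List.exists_cons_of_ne_nil hl.1
  have key : ∀ m n z, (∀ z, Sh (lpow l m) (lpow l n) z → z ≤ lpow l (m + n)) →
      Sh (t ++ lpow l m) (lpow l n) z → x :: z ≤ lpow l (m + n + 1) := by
    intro m n z hmn hz
    rw [lpow_succ, e, List.cons_append, ← e]
    exact List.cons_le_cons _ ((Sh.le_append hmn (hl.lpow_lt_suffix e n) z).1 hz)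
  generalize hN : m + n = N
  induction N generalizing m n z with
  | zero =>
    obtain ⟨rfl, rfl⟩ : m = 0 ∧ n = 0 := by omega
    rw [h.eq_of_nil_left]
  | succ N ih =>
    cases m with
    | zero =>
      rw [h.eq_of_nil_left, ← hN, zero_add]
    | succ m =>
      cases n with
      | zero => rw [h.eq_of_nil_right, ← hN, add_zero]
      | succ n =>
        have h' := h
        rw [lpow_succ, lpow_succ, e, List.cons_append, List.cons_append, ← e] at h'
        cases h' with
        | left h' =>
          rw [← List.cons_append, ← e, ← lpow_succ] at h'
          have := key m (n + 1) _ (fun z hz => (ih m (n + 1) hz (by omega)).trans_eq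
            (by congr 1; omega)) h'
          rwa [show m + (n + 1) + 1 = N + 1 by omega] at this
        | right h' =>
          rw [← List.cons_append, ← e, ← lpow_succ] at h'
          have := key n (m + 1) _ (fun z hz => (ih n (m + 1) hz (by omega)).trans_eq
            (by congr 1; omega)) h'.symm
          rwa [show n + (m + 1) + 1 = N + 1 by omega] at this

end Words

section QBinomial

variable {k : Type*} [Field k]

/-- Gaussian binomial coefficients. -/
def qbinom (q : k) : ℕ → ℕ → k
  | _, 0 => 1
  | 0, _ + 1 => 0
  | n + 1, r + 1 => q ^ (n - r) * qbinom q n r + qbinom q n (r + 1)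

theorem qbinom_zero_right (q : k) (n : ℕ) : qbinom q n 0 = 1 := by
  cases n <;> rfl

theorem qbinom_succ_succ (q : k) (n r : ℕ) :
    qbinom q (n + 1) (r + 1) = q ^ (n - r) * qbinom q n r + qbinom q n (r + 1) := rfl

theorem qbinom_eq_zero (q : k) {n r : ℕ} (h : n < r) : qbinom q n r = 0 := by
  induction n generalizing r with
  | zero =>
    cases r with
    | zero => omega
    | succ r => rfl
  | succ n ih =>
    cases r with
    | zero => omega
    | succ r => rw [qbinom_succ_succ, ih (by omega), ih (by omega), mul_zero, add_zero]

theorem qbinom_self (q : k) (n : ℕ) : qbinom q n n = 1 := by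
  induction n with
  | zero => rfl
  | succ n ih => rw [qbinom_succ_succ, ih, qbinom_eq_zero q n.lt_succ_self]; simp

theorem qbinom_add_of_vanishing {q : k} {s : ℕ} (hs : ∀ i, 0 < i → i < s → qbinom q s i = 0)
    (n : ℕ) {r : ℕ} (hr : r < s) : qbinom q (n + s) r = q ^ (r * s) * qbinom q n r := by
  induction n generalizing r with
  | zero =>
    cases r with
    | zero => simp [qbinom_zero_right]
    | succ r => rw [zero_add, hs _ r.succ_pos hr, qbinom_eq_zero q r.succ_pos, mul_zero]
  | succ n ih =>
    cases r with
    | zero => simp [qbinom_zero_right]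
    | succ r =>
      rw [show n + 1 + s = n + s + 1 by omega, qbinom_succ_succ, ih (by omega), ih hr,
        qbinom_succ_succ]
      rcases le_or_gt r n with h | h
      · rw [mul_add, ← mul_assoc, ← mul_assoc, ← pow_add, ← pow_add]
        congr 3
        rw [add_mul]
        omega
      · simp [qbinom_eq_zero q h]

theorem qbinom_ne_zero_of_vanishing {q : k} (hq : q ≠ 0) {s : ℕ}
    (hs : ∀ i, 0 < i → i < s → qbinom q s i = 0) (a : ℕ) {r : ℕ} (hr : r < s) :
    qbinom q (r + s * a) r ≠ 0 := by
  induction a with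
  | zero => simp [qbinom_self]
  | succ a ih =>
    rw [mul_add, mul_one, ← add_assoc, qbinom_add_of_vanishing hs _ hr]
    exact mul_ne_zero (pow_ne_zero _ hq) ih

end QBinomial

/-- A bialgebra generated by linearly independent group-like elements `γ g` and skew-primitive
semi-invariants `x i`. -/
structure CharData (k H I G : Type*) [Field k] [Ring H] [Bialgebra k H] [Group G] where
  γ : G →* H
  x : I → H
  d : I → G
  χ : I → G →* k
  comul_γ : ∀ g, Coalgebra.comul (R := k) (γ g) = γ g ⊗ₜ[k] γ g
  comul_x : ∀ i, Coalgebra.comul (R := k) (x i) = x i ⊗ₜ[k] 1 + γ (d i) ⊗ₜ[k] x i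
  x_mul_γ : ∀ i g, x i * γ g = χ i g • (γ g * x i)
  linearIndependent_γ : LinearIndependent k γ
  adjoin_eq_top : Algebra.adjoin k (Set.range γ ∪ Set.range x) = ⊤

namespace CharData

variable {k H I G : Type*} [Field k] [Ring H] [Bialgebra k H] [Group G]
variable (D : CharData k H I G)

/-- The product of the generators along a word. -/
def X (w : List I) : H := (w.map D.x).prod

/-- The group element attached to a word. -/
def deg (w : List I) : G := (w.map D.d).prod

/-- The character attached to a word. -/
def chi (w : List I) : G →* k := (w.map D.χ).prod

theorem X_nil : D.X [] = 1 := rfl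

theorem X_cons (a : I) (w : List I) : D.X (a :: w) = D.x a * D.X w := by simp [X]

theorem X_append (u v : List I) : D.X (u ++ v) = D.X u * D.X v := by simp [X]

theorem deg_nil : D.deg [] = 1 := rfl

theorem deg_cons (a : I) (w : List I) : D.deg (a :: w) = D.d a * D.deg w := by simp [deg]

theorem deg_lpow (l : List I) (n : ℕ) : D.deg (lpow l n) = D.deg l ^ n := by
  induction n with
  | zero => simp [lpow_zero, deg_nil]
  | succ n ih =>
    rw [lpow_succ, pow_succ', ← ih]
    simp [deg]

theorem chi_cons (a : I) (w : List I) : D.chi (a :: w) = D.χ a * D.chi w := by simp [chi]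

theorem chi_ne_zero (w : List I) (g : G) : D.chi w g ≠ 0 := by
  intro h
  have : D.chi w (g * g⁻¹) = 0 := by rw [map_mul, h, zero_mul]
  simp at this

theorem X_mul_γ (w : List I) (g : G) : D.X w * D.γ g = D.chi w g • (D.γ g * D.X w) := by
  induction w with
  | nil => simp [X, chi]
  | cons a w ih =>
    rw [X_cons, mul_assoc, ih, mul_smul_comm, ← mul_assoc, D.x_mul_γ, chi_cons,
      MonoidHom.mul_apply, smul_mul_assoc, smul_smul, mul_comm (D.χ a g), mul_assoc]

/-- The coefficients of the coproduct of a word. -/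
noncomputable def coef : List I → (List I × List I) →₀ k
  | [] => Finsupp.single ([], []) 1
  | a :: z => (coef z).sum fun p c =>
      Finsupp.single (a :: p.1, p.2) (D.χ a (D.deg p.2) * c) + Finsupp.single (p.1, a :: p.2) c

theorem comul_X (w : List I) : Coalgebra.comul (R := k) (D.X w) =
    (D.coef w).sum fun p c => c • ((D.γ (D.deg p.2) * D.X p.1) ⊗ₜ[k] D.X p.2) := by
  induction w with
  | nil => simp [coef, X_nil, deg_nil, Bialgebra.comul_one, Algebra.TensorProduct.one_def]
  | cons a w ih =>
    rw [X_cons, Bialgebra.comul_mul, ih, coef, Finsupp.sum_sum_index (by simp)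
      (by intros; rw [add_smul]), Finsupp.mul_sum]
    refine Finsupp.sum_congr fun p _ => ?_
    rw [Finsupp.sum_add_index' (by simp) (by intros; rw [add_smul]),
      Finsupp.sum_single_index (by simp), Finsupp.sum_single_index (by simp), D.comul_x,
      mul_smul_comm, add_mul, Algebra.TensorProduct.tmul_mul_tmul,
      Algebra.TensorProduct.tmul_mul_tmul, ← mul_assoc, D.x_mul_γ, one_mul, smul_mul_assoc,
      smul_add, ← TensorProduct.smul_tmul', smul_smul, mul_comm (D.coef w p), mul_assoc, ← X_cons,
      deg_cons, ← mul_assoc (D.γ _) (D.γ _), ← map_mul, ← X_cons]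

open Classical in
theorem coef_cons (a : I) (z u v : List I) : D.coef (a :: z) (u, v) =
    (match u with
      | [] => 0
      | b :: u' => if b = a then D.χ a (D.deg v) * D.coef z (u', v) else 0) +
    (match v with
      | [] => 0
      | b :: v' => if b = a then D.coef z (u, v') else 0) := by
  rw [coef, Finsupp.sum_apply]
  simp only [Finsupp.add_apply, Finsupp.single_apply, Finsupp.sum_add]
  congr 1
  · cases u with
    | nil => simp [Finsupp.sum]
    | cons b u =>
      by_cases h : b = a
      · subst h
        simp only [Prod.mk.injEq, List.cons.injEq, true_and, if_true]
        rw [Finsupp.sum, Finset.sum_eq_single (u, v)]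
        · simp
        · rintro ⟨p, q⟩ _ hne
          rw [if_neg]
          simpa using hne
        · intro h
          simp [Finsupp.notMem_support_iff.1 h]
      · simp [Finsupp.sum, h, Ne.symm h]
  · cases v with
    | nil => simp [Finsupp.sum]
    | cons b v =>
      by_cases h : b = a
      · subst h
        simp only [Prod.mk.injEq, List.cons.injEq, true_and, if_true]
        rw [Finsupp.sum, Finset.sum_eq_single (u, v)]
        · simp
        · rintro ⟨p, q⟩ _ hne
          rw [if_neg]
          simpa using hne
        · intro h
          simp [Finsupp.notMem_support_iff.1 h]
      · simp [Finsupp.sum, h, Ne.symm h]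

theorem ne_zero_or_ne_zero_of_add {a b : k} (h : a + b ≠ 0) : a ≠ 0 ∨ b ≠ 0 := by
  by_contra! h'
  exact h (by rw [h'.1, h'.2, add_zero])

theorem sh_of_coef_ne_zero {z u v : List I} (h : D.coef z (u, v) ≠ 0) : Sh u v z := by
  classical
  induction z generalizing u v with
  | nil =>
    rw [coef, Finsupp.single_apply] at h
    obtain ⟨rfl, rfl⟩ : [] = u ∧ [] = v := by simpa using h
    exact .nil
  | cons a z ih =>
    rw [coef_cons] at h
    rcases ne_zero_or_ne_zero_of_add h with h | h
    · cases u with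
      | nil => simp at h
      | cons b u =>
        obtain ⟨rfl, h⟩ := by simpa using h
        exact .left (ih h.2)
    · cases v with
      | nil => simp at h
      | cons b v =>
        obtain rfl : b = a := by by_contra hne; simp [hne] at h
        exact .right (ih (by simpa using h))

theorem coef_append_left {t b v z : List I} (h : ¬ Early b t v (t ++ z)) :
    D.coef (t ++ z) (t ++ b, v) = D.chi t (D.deg v) * D.coef z (b, v) := by
  classical
  induction t with
  | nil => simp [chi]
  | cons x t ih =>
    rw [List.cons_append, List.cons_append, coef_cons]
    have hr : (match v with
      | [] => 0
      | c :: v' => if c = x then D.coef (t ++ z) (x :: (t ++ b), v') else 0) = 0 := by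
      by_contra hne
      cases v with
      | nil => simp at hne
      | cons c v =>
        obtain ⟨rfl, hne⟩ := by simpa using hne
        exact h (.here (by simp) (D.sh_of_coef_ne_zero hne))
    simp only [hr, add_zero, if_true]
    rw [ih fun h' => h (.left h'), chi_cons, MonoidHom.mul_apply, mul_assoc]

theorem coef_append_right {t b v z : List I} (h : ¬ Early b t v (t ++ z)) :
    D.coef (t ++ z) (v, t ++ b) = D.coef z (v, b) := by
  classical
  induction t with
  | nil => simp
  | cons x t ih =>
    rw [List.cons_append, List.cons_append, coef_cons]
    have hl : (match v with
      | [] => 0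
      | c :: v' => if c = x then D.χ x (D.deg (x :: (t ++ b))) *
          D.coef (t ++ z) (v', x :: (t ++ b)) else 0) = 0 := by
      by_contra hne
      cases v with
      | nil => simp at hne
      | cons c v =>
        obtain ⟨rfl, hne⟩ := by simpa using hne
        exact h (.here (by simp) (D.sh_of_coef_ne_zero hne.2).symm)
    simp only [hl, zero_add, if_true]
    exact ih fun h' => h (.left h')

theorem coef_nil_left (v : List I) : D.coef v ([], v) = 1 := by
  classical
  induction v with
  | nil => simp [coef]
  | cons a v ih => rw [coef_cons]; simpa using ih

theorem coef_nil_right (v : List I) : D.coef v (v, []) = 1 := by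
  classical
  induction v with
  | nil => simp [coef]
  | cons a v ih => rw [coef_cons]; simpa [deg_nil] using ih

variable [LinearOrder I]

theorem coef_lpow_append {l v : List I} (hl : IsLyndon l) (hv : v < l) (n : ℕ) :
    D.coef (lpow l n ++ v) (lpow l n, v) ≠ 0 ∧ D.coef (lpow l n ++ v) (v, lpow l n) ≠ 0 := by
  have h : ¬ Early [] (lpow l n) v (lpow l n ++ v) := fun h =>
    lt_irrefl _ ((Sh.le_append (fun _ hz => hz.eq_of_nil_left.le) (hl.lt_suffix hv n) _).2 h)
  have h1 := D.coef_append_left h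
  have h2 := D.coef_append_right h
  rw [List.append_nil] at h1 h2
  rw [h1, h2, coef_nil_left, coef_nil_right, mul_one]
  exact ⟨D.chi_ne_zero _ _, one_ne_zero⟩

theorem coef_lpow_lpow {l : List I} (hl : IsLyndon l) (m n : ℕ) :
    D.coef (lpow l (m + n)) (lpow l m, lpow l n) =
      qbinom (D.chi l (D.deg l)) (m + n) m := by
  classical
  obtain ⟨x, t, e⟩ := List.exists_cons_of_ne_nil hl.1
  have key : ∀ m n, ¬ Early (lpow l m) t (lpow l n) (t ++ lpow l (m + n)) := fun m n h =>
    lt_irrefl _ ((Sh.le_append (fun z hz => hl.sh_lpow_lpow_le m n hz)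
      (hl.lpow_lt_suffix e n) _).2 h)
  have hcons : ∀ n, lpow l (n + 1) = x :: (t ++ lpow l n) := fun n => by
    rw [lpow_succ]
    nth_rw 1 [e]
    rfl
  generalize hN : m + n = N
  induction N generalizing m n with
  | zero =>
    obtain ⟨rfl, rfl⟩ : m = 0 ∧ n = 0 := by omega
    simp [lpow_zero, coef, qbinom]
  | succ N ih =>
    cases m with
    | zero =>
      obtain rfl : n = N + 1 := by omega
      rw [lpow_zero, coef_nil_left, qbinom_zero_right]
    | succ m =>
      cases n with
      | zero =>
        obtain rfl : m = N := by omega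
        rw [lpow_zero, coef_nil_right, qbinom_self]
      | succ n =>
        have h1 := D.coef_append_left (key m (n + 1))
        have h2 := D.coef_append_right (key n (m + 1))
        rw [show m + (n + 1) = N by omega] at h1
        rw [show n + (m + 1) = N by omega] at h2
        rw [hcons N, coef_cons, hcons m, hcons n]
        simp only [if_true]
        rw [← hcons n, ← hcons m, h1, h2, ih m (n + 1) (by omega), ih (m + 1) n (by omega),
          qbinom_succ_succ, ← mul_assoc, ← MonoidHom.mul_apply, ← chi_cons, ← e, deg_lpow,
          map_pow, show N - m = n + 1 by omega]

end CharData

section Order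

variable {α : Type*} [LinearOrder α]

/-- The key by which words are compared: first by length, then by the reverse of the
lexicographic order. -/
def key (w : List α) : ℕ ×ₗ (List α)ᵒᵈ := toLex (w.length, OrderDual.toDual w)

omit [LinearOrder α] in
theorem key_injective : Function.Injective (key (α := α)) := fun v w h => by
  simpa [key] using (congrArg (fun p => (ofLex p).2) h)

/-- `Lo v w` : the word `v` is shorter than `w`, or of the same length and lexicographically
larger. -/
def Lo (v w : List α) : Prop := key v < key w

theorem lo_iff {v w : List α} :
    Lo v w ↔ v.length < w.length ∨ v.length = w.length ∧ w < v := by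
  simp [Lo, key, Prod.Lex.toLex_lt_toLex]

theorem Lo.trans {u v w : List α} (h : Lo u v) (h' : Lo v w) : Lo u w := lt_trans h h'

theorem not_lo_nil (v : List α) : ¬ Lo v [] := by
  rw [lo_iff]
  rintro (h | ⟨h, h'⟩)
  · simp at h
  · rw [List.length_eq_zero_iff.1 h] at h'
    exact lt_irrefl _ h'

theorem Lo.append_left {v w : List α} (h : Lo v w) (a : List α) : Lo (a ++ v) (a ++ w) := by
  rw [lo_iff] at h ⊢
  rcases h with h | ⟨h, h'⟩
  · left; simpa
  · exact .inr ⟨by simpa, append_lt_append_left a h'⟩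

theorem Lo.append_right {v w : List α} (h : Lo v w) (a : List α) : Lo (v ++ a) (w ++ a) := by
  rw [lo_iff] at h ⊢
  rcases h with h | ⟨h, h'⟩
  · left; simpa
  · exact .inr ⟨by simpa, append_lt_append_of_length_le h' h.le a a⟩

theorem lex_gt_of_lt {v w : List α} (hl : v.length = w.length) (h : w < v) :
    List.Lex (· > ·) v w := by
  induction v generalizing w with
  | nil => simp at h
  | cons a v ih =>
    cases w with
    | nil => simp at hl
    | cons b w =>
      rcases List.cons_lt_cons_iff.1 h with hab | ⟨rfl, hwv⟩
      · exact .rel hab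
      · exact .cons (ih (by simpa using hl) hwv)

theorem wellFounded_lo [WellFoundedGT α] : WellFounded (Lo (α := α)) := by
  refine Subrelation.wf (r := List.Shortlex (· > ·)) (fun {v w} h => ?_)
    (List.Shortlex.wf wellFounded_gt)
  rw [List.shortlex_def]
  rcases lo_iff.1 h with h | ⟨h, h'⟩
  exacts [.inl h, .inr ⟨h, lex_gt_of_lt h h'⟩]

/-- A pair of words with a shuffle that is not too small either is dominated in one of its
components or is the extremal pair. -/
theorem Sh.lo_or_lo {u v z a b w : List α} (h : Sh u v z) (hw : w.length = a.length + b.length)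
    (hmax : ∀ y, Sh a b y → y ≤ w) (hz : key z ≤ key w) :
    Lo u a ∨ Lo v b ∨ (z = w ∧ u = a ∧ v = b) := by
  have hlen := h.length_eq
  by_contra! hne
  simp only [lo_iff, not_or, not_and, not_lt] at hne
  obtain ⟨⟨hu1, hu2⟩, ⟨hv1, hv2⟩, hne⟩ := hne
  have hz' : z = w ∨ Lo z w := hz.eq_or_lt.imp (fun h => key_injective h) id
  have hzl : z.length = w.length ∧ w ≤ z := by
    rcases hz' with rfl | hz'
    · exact ⟨rfl, le_rfl⟩
    · rcases lo_iff.1 hz' with h' | ⟨h', h''⟩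
      · omega
      · exact ⟨h', h''.le⟩
  have hua : u.length = a.length := by omega
  have hvb : v.length = b.length := by omega
  obtain ⟨y, hy, hzy, heq⟩ := h.exists_ge hua hvb (hu2 hua) (hv2 hvb)
  have hyw := hmax y hy
  obtain rfl : z = w := le_antisymm (hzy.trans hyw) hzl.2
  obtain ⟨rfl, rfl⟩ := heq (le_antisymm hzy hyw)
  exact hne rfl rfl rfl

end Order

namespace CharData

variable {k H I G : Type*} [Field k] [Ring H] [Bialgebra k H] [Group G]
variable (D : CharData k H I G)

theorem γ_mul_X_mul (g g' : G) (v w : List I) : (D.γ g * D.X v) * (D.γ g' * D.X w) =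
    D.chi v g' • (D.γ (g * g') * D.X (v ++ w)) := by
  rw [mul_assoc, ← mul_assoc (D.X v), D.X_mul_γ, smul_mul_assoc, mul_smul_comm, map_mul,
    X_append]
  simp only [mul_assoc]

theorem γ_inv_mul (g : G) (y : H) : D.γ g⁻¹ * (D.γ g * y) = y := by
  rw [← mul_assoc, ← map_mul, inv_mul_cancel, map_one, one_mul]

theorem span_γ_mul_X :
    Submodule.span k (Set.range fun p : G × List I => D.γ p.1 * D.X p.2) = ⊤ := by
  set S := Submodule.span k (Set.range fun p : G × List I => D.γ p.1 * D.X p.2) with hS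
  have hmem : ∀ g w, D.γ g * D.X w ∈ S := fun g w => Submodule.subset_span ⟨(g, w), rfl⟩
  have key : ∀ h ∈ Algebra.adjoin k (Set.range D.γ ∪ Set.range D.x), ∀ y ∈ S, h * y ∈ S := by
    intro h hh
    induction hh using Algebra.adjoin_induction with
    | mem a ha =>
      intro y hy
      have : S ≤ S.comap (LinearMap.mulLeft k a) := by
        rw [hS, Submodule.span_le, ← hS]
        rintro _ ⟨⟨g, w⟩, rfl⟩
        change a * (D.γ g * D.X w) ∈ S
        rcases ha with ⟨g', rfl⟩ | ⟨i, rfl⟩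
        · rw [← mul_assoc, ← map_mul]
          exact hmem _ _
        · rw [← mul_assoc, D.x_mul_γ, smul_mul_assoc, mul_assoc, ← X_cons]
          exact S.smul_mem _ (hmem _ _)
      exact this hy
    | algebraMap r =>
      intro y hy
      rw [← Algebra.smul_def]
      exact S.smul_mem _ hy
    | add a b _ _ iha ihb => intro y hy; rw [add_mul]; exact S.add_mem (iha y hy) (ihb y hy)
    | mul a b _ _ iha ihb => intro y hy; rw [mul_assoc]; exact iha _ (ihb y hy)
  refine eq_top_iff.2 fun h _ => ?_
  have := key h (by rw [D.adjoin_eq_top]; trivial) 1 (by simpa [X_nil] using hmem 1 [])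
  rwa [mul_one] at this

theorem exists_dual : ∃ δ : G → H →ₗ[k] k, ∀ g g', δ g (D.γ g') = Finsupp.single g' 1 g := by
  obtain ⟨π, hπ⟩ := (Finsupp.linearCombination k D.γ).exists_leftInverse_of_injective
    (LinearMap.ker_eq_bot.2 D.linearIndependent_γ)
  refine ⟨fun g => Finsupp.lapply g ∘ₗ π, fun g g' => ?_⟩
  have := LinearMap.congr_fun hπ (Finsupp.single g' 1)
  simp only [LinearMap.comp_apply, Finsupp.linearCombination_single, one_smul,
    LinearMap.id_apply] at this
  simp [this]

/-- Contraction of the coproduct with a linear functional on the right factor. -/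
noncomputable def contract (f : H →ₗ[k] k) : H →ₗ[k] H :=
  (TensorProduct.rid k H).toLinearMap ∘ₗ f.lTensor H ∘ₗ Coalgebra.comul

theorem contract_γ_mul_X (f : H →ₗ[k] k) (g : G) (w : List I) : contract f (D.γ g * D.X w) =
    (D.coef w).sum fun p c =>
      (c * f (D.γ g * D.X p.2)) • (D.γ (g * D.deg p.2) * D.X p.1) := by
  rw [contract, LinearMap.comp_apply, LinearMap.comp_apply, Bialgebra.comul_mul, D.comul_γ,
    D.comul_X, Finsupp.mul_sum, Finsupp.sum, map_sum, map_sum]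
  refine Finset.sum_congr rfl fun p _ => ?_
  rw [mul_smul_comm, Algebra.TensorProduct.tmul_mul_tmul, map_smul, map_smul,
    LinearMap.lTensor_tmul, LinearEquiv.coe_coe, TensorProduct.rid_tmul, smul_smul, ← mul_assoc,
    ← map_mul]

variable [LinearOrder I]

/-- The span of the elements `γ g * X v` with `v` below `w`. -/
def F (w : List I) : Submodule k H :=
  Submodule.span k {y | ∃ g v, Lo v w ∧ y = D.γ g * D.X v}

theorem γ_mul_X_mem_F {v w : List I} (h : Lo v w) (g : G) : D.γ g * D.X v ∈ D.F w :=
  Submodule.subset_span ⟨g, v, h, rfl⟩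

theorem F_le_iff {w : List I} {S : Submodule k H} :
    D.F w ≤ S ↔ ∀ g v, Lo v w → D.γ g * D.X v ∈ S := by
  rw [F, Submodule.span_le]
  exact ⟨fun h g v hv => h ⟨g, v, hv, rfl⟩, by rintro h _ ⟨g, v, hv, rfl⟩; exact h g v hv⟩

theorem F_mono {v w : List I} (h : Lo v w) : D.F v ≤ D.F w :=
  D.F_le_iff.2 fun _ _ hu => D.γ_mul_X_mem_F (hu.trans h) _

theorem F_nil : D.F [] = ⊥ :=
  le_bot_iff.1 (D.F_le_iff.2 fun _ v h => absurd h (not_lo_nil v))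

theorem γ_mul_mem_F {w : List I} {y : H} (hy : y ∈ D.F w) (g : G) : D.γ g * y ∈ D.F w := by
  have : D.F w ≤ (D.F w).comap (LinearMap.mulLeft k (D.γ g)) :=
    D.F_le_iff.2 fun g' v hv => by
      simpa [← mul_assoc, ← map_mul] using D.γ_mul_X_mem_F hv (g * g')
  exact this hy

theorem F_mul_X {a : List I} {y : H} (hy : y ∈ D.F a) (g : G) (v : List I) :
    y * (D.γ g * D.X v) ∈ D.F (a ++ v) := by
  have : D.F a ≤ (D.F (a ++ v)).comap (LinearMap.mulRight k (D.γ g * D.X v)) :=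
    D.F_le_iff.2 fun g' u hu => by
      simpa only [Submodule.mem_comap, LinearMap.mulRight_apply, γ_mul_X_mul] using
        Submodule.smul_mem _ _ (D.γ_mul_X_mem_F (hu.append_right v) _)
  exact this hy

theorem X_mul_F {a : List I} {y : H} (hy : y ∈ D.F a) (v : List I) :
    D.X v * y ∈ D.F (v ++ a) := by
  have : D.F a ≤ (D.F (v ++ a)).comap (LinearMap.mulLeft k (D.X v)) :=
    D.F_le_iff.2 fun g' u hu => by
      have := D.γ_mul_X_mul 1 g' v u
      rw [map_one, one_mul] at this
      simpa only [Submodule.mem_comap, LinearMap.mulLeft_apply, this] using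
        Submodule.smul_mem _ _ (D.γ_mul_X_mem_F (hu.append_left v) _)
  exact this hy

theorem F_mul_F {a b : List I} {y z : H} (hy : y ∈ D.F a) (hz : z ∈ D.F b) :
    y * z ∈ D.F (a ++ b) := by
  have : D.F b ≤ (D.F (a ++ b)).comap (LinearMap.mulLeft k y) :=
    D.F_le_iff.2 fun g v hv => D.F_mono (hv.append_left a) (D.F_mul_X hy g v)
  exact this hz

/-- `u` has leading word `w`. -/
def Lead (u : H) (w : List I) : Prop := u - D.X w ∈ D.F w

theorem lead_X (w : List I) : D.Lead (D.X w) w := by simp [Lead]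

theorem Lead.mul {D : CharData k H I G} {u v : H} {a b : List I} (hu : D.Lead u a)
    (hv : D.Lead v b) : D.Lead (u * v) (a ++ b) := by
  have h1 := D.F_mul_F hu hv
  have h2 := D.F_mul_X hu 1 b
  have h3 := D.X_mul_F hv a
  rw [map_one, one_mul] at h2
  rw [Lead, X_append]
  convert add_mem (add_mem h1 h2) h3 using 1
  noncomm_ring

theorem Lead.one : D.Lead 1 [] := D.lead_X []

theorem Lead.pow {D : CharData k H I G} {u : H} {a : List I} (hu : D.Lead u a) (n : ℕ) :
    D.Lead (u ^ n) (lpow a n) := by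
  induction n with
  | zero => simpa [lpow_zero] using Lead.one D
  | succ n ih => rw [pow_succ', lpow_succ]; exact hu.mul ih

theorem Lead.mem_F {D : CharData k H I G} {u : H} {v w : List I} (hu : D.Lead u v)
    (h : Lo v w) : u ∈ D.F w := by
  have h1 := D.γ_mul_X_mem_F h 1
  rw [map_one, one_mul] at h1
  simpa using add_mem (D.F_mono h hu) h1

theorem contract_sub_mem_F (f : H →ₗ[k] k) (g : G) (w : List I) :
    contract f (D.γ g * D.X w) - f (D.γ g) • (D.γ g * D.X w) ∈ D.F w := by
  classical
  have hw : D.coef w (w, []) = 1 := D.coef_nil_right w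
  rw [contract_γ_mul_X, Finsupp.sum, ← Finset.sum_erase_add _ _
    (Finsupp.mem_support_iff.2 (hw.trans_ne one_ne_zero)), hw]
  simp only [X_nil, deg_nil, mul_one, one_mul, add_sub_cancel_right]
  refine Submodule.sum_mem _ fun p hp => Submodule.smul_mem _ _ (D.γ_mul_X_mem_F ?_ _)
  rw [Finset.mem_erase, Finsupp.mem_support_iff] at hp
  have hsh := D.sh_of_coef_ne_zero hp.2
  obtain ⟨p1, p2⟩ := p
  cases p2 with
  | nil => exact absurd (by rw [hsh.eq_of_nil_right]) hp.1
  | cons a v => exact lo_iff.2 (.inl (by rw [hsh.length_eq]; simp))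

theorem contract_mem_F (f : H →ₗ[k] k) {w : List I} {y : H} (hy : y ∈ D.F w) :
    contract f y ∈ D.F w := by
  have : D.F w ≤ (D.F w).comap (contract f) := D.F_le_iff.2 fun g v hv => by
    have := add_mem (D.F_mono hv (D.contract_sub_mem_F f g v))
      (Submodule.smul_mem _ (f (D.γ g)) (D.γ_mul_X_mem_F hv g))
    simpa using this
  exact this hy

theorem Lead.contract_sub_mem_F {D : CharData k H I G} {u : H} {w : List I} (hu : D.Lead u w)
    (f : H →ₗ[k] k) (g : G) : contract f (D.γ g * u) - f (D.γ g) • (D.γ g * u) ∈ D.F w := by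
  have h1 := D.γ_mul_mem_F hu g
  convert add_mem (D.contract_sub_mem_F f g w)
    (sub_mem (D.contract_mem_F f h1) (Submodule.smul_mem _ (f (D.γ g)) h1)) using 1
  simp only [mul_sub, map_sub, smul_sub]
  abel

/-- The words which are not reducible to lower ones. -/
def B : Set (List I) := {w | D.X w ∉ D.F w}

theorem nil_mem_B : [] ∈ D.B := by
  have := D.linearIndependent_γ.ne_zero 1
  simpa [B, F_nil, X_nil] using this

theorem left_mem_B {a b : List I} (h : a ++ b ∈ D.B) : a ∈ D.B := fun h' => h <| by
  simpa [X_append] using D.F_mul_X h' 1 b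

theorem right_mem_B {a b : List I} (h : a ++ b ∈ D.B) : b ∈ D.B := fun h' => h <| by
  simpa [X_append] using D.X_mul_F h' a

variable {e : D.B → H}

theorem exists_lead_contract (he : ∀ b, D.Lead (e b) b) {c : G × D.B →₀ k} (hc : c ≠ 0) :
    ∃ g b, ∃ f : H →ₗ[k] k, c (g, b) ≠ 0 ∧
      D.Lead (D.γ g⁻¹ * contract f (Finsupp.linearCombination k (fun p => D.γ p.1 * e p.2) c))
        b := by
  classical
  obtain ⟨⟨g, b⟩, hgb, hmax⟩ := Finset.exists_max_image c.support
    (fun p => key (p.2 : List I)) (Finsupp.support_nonempty_iff.2 hc)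
  obtain ⟨δ, hδ⟩ := D.exists_dual
  have hc' := Finsupp.mem_support_iff.1 hgb
  refine ⟨g, b, (c (g, b))⁻¹ • δ g, hc', ?_⟩
  set f := (c (g, b))⁻¹ • δ g with hf
  suffices h : contract f (Finsupp.linearCombination k (fun p => D.γ p.1 * e p.2) c) - D.γ g * e b ∈
      D.F b by
    have := add_mem (D.γ_mul_mem_F h g⁻¹) (he b)
    rw [mul_sub, γ_inv_mul, sub_add_sub_cancel] at this
    exact this
  rw [Finsupp.linearCombination_apply, Finsupp.sum, ← Finset.sum_erase_add _ _ hgb, map_add,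
    map_sum, add_sub_assoc]
  refine add_mem (Submodule.sum_mem _ fun p hp => ?_) ?_
  · obtain ⟨g', b'⟩ := p
    rw [Finset.mem_erase] at hp
    rw [map_smul]
    refine Submodule.smul_mem _ _ ?_
    rcases (hmax _ hp.2).lt_or_eq with h | h
    · exact D.contract_mem_F f (D.γ_mul_mem_F ((he b').mem_F h) g')
    · obtain rfl : b' = b := Subtype.ext (key_injective h)
      have := (he b').contract_sub_mem_F f g'
      have hg : g' ≠ g := by rintro rfl; exact hp.1 rfl
      have h0 : f (D.γ g') = 0 := by simp [hf, hδ, hg]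
      rwa [h0, zero_smul, sub_zero] at this
  · have := Submodule.smul_mem _ (c (g, b)) ((he b).contract_sub_mem_F f g)
    have h1 : f (D.γ g) = (c (g, b))⁻¹ := by simp [hf, hδ]
    rwa [h1, smul_sub, smul_smul, mul_inv_cancel₀ hc', one_smul, ← map_smul] at this

theorem linearIndependent_γ_mul (he : ∀ b, D.Lead (e b) b) :
    LinearIndependent k fun p : G × D.B => D.γ p.1 * e p.2 := by
  rw [linearIndependent_iff]
  intro c hc
  by_contra hne
  obtain ⟨g, b, f, -, h⟩ := D.exists_lead_contract he hne
  rw [hc, map_zero, mul_zero, Lead, zero_sub, neg_mem_iff] at h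
  exact b.2 h

variable [WellFoundedGT I]

theorem span_γ_mul (he : ∀ b, D.Lead (e b) b) :
    Submodule.span k (Set.range fun p : G × D.B => D.γ p.1 * e p.2) = ⊤ := by
  set S := Submodule.span k (Set.range fun p : G × D.B => D.γ p.1 * e p.2) with hS
  have hγ : ∀ g, S ≤ S.comap (LinearMap.mulLeft k (D.γ g)) := fun g => by
    rw [hS, Submodule.span_le, ← hS]
    rintro _ ⟨⟨g', b⟩, rfl⟩
    exact Submodule.subset_span ⟨(g * g', b), by simp [mul_assoc]⟩
  have key : ∀ w g, D.γ g * D.X w ∈ S := fun w => by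
    refine wellFounded_lo.induction (C := fun w => ∀ g, D.γ g * D.X w ∈ S) w fun w ih => ?_
    have hF : D.F w ≤ S := D.F_le_iff.2 fun g v hv => ih v hv g
    refine fun g => hγ g ?_
    by_cases hw : w ∈ D.B
    · have h1 : e ⟨w, hw⟩ ∈ S := Submodule.subset_span ⟨(1, ⟨w, hw⟩), by simp⟩
      simpa using sub_mem h1 (hF (he ⟨w, hw⟩))
    · exact hF (not_not.1 hw)
  rw [eq_top_iff, ← D.span_γ_mul_X, Submodule.span_le]
  rintro _ ⟨⟨g, w⟩, rfl⟩
  exact key w g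

theorem exists_dual_word {b : List I} (hb : b ∈ D.B) : ∃ f : H →ₗ[k] k,
    (∀ g y, f (D.γ g * y) = f y) ∧ (∀ v, Lo v b → f (D.X v) = 0) ∧ f (D.X b) = 1 := by
  classical
  have he : ∀ b : D.B, D.Lead (D.X b) b := fun b => D.lead_X b
  let β : Module.Basis (G × D.B) k H :=
    .mk (D.linearIndependent_γ_mul he) (D.span_γ_mul he).ge
  have hβ : ∀ p, β p = D.γ p.1 * D.X p.2 := fun p => by simp [β]
  let f : H →ₗ[k] k := β.constr k fun p => if p.2 = ⟨b, hb⟩ then 1 else 0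
  have hf : ∀ g (b' : D.B), f (D.γ g * D.X b') = if b' = ⟨b, hb⟩ then 1 else 0 := fun g b' => by
    rw [← hβ (g, b'), Module.Basis.constr_basis]
  have hγ : ∀ g y, f (D.γ g * y) = f y := fun g y => by
    have : f ∘ₗ LinearMap.mulLeft k (D.γ g) = f := β.ext fun p => by
      rw [hβ, LinearMap.comp_apply, LinearMap.mulLeft_apply, ← mul_assoc, ← map_mul, hf, hf]
    exact LinearMap.congr_fun this y
  refine ⟨f, hγ, fun v => ?_, ?_⟩
  · refine wellFounded_lo.induction (C := fun v => Lo v b → f (D.X v) = 0) v fun v ih hv => ?_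
    by_cases hvB : v ∈ D.B
    · have := hf 1 ⟨v, hvB⟩
      rw [hγ, if_neg] at this
      · exact this
      · rintro h
        obtain rfl : v = b := congrArg Subtype.val h
        exact lt_irrefl _ hv
    · have : D.F v ≤ LinearMap.ker f := D.F_le_iff.2 fun g u hu => by
        rw [LinearMap.mem_ker, hγ, ih u hu (hu.trans hv)]
      exact this (not_not.1 hvB)
  · have := hf 1 ⟨b, hb⟩
    rwa [hγ, if_pos rfl] at this

/-- Contraction against the dual of `b` sends the filtration below `w` to that below `a`, and the
leading term `w` to a multiple of the leading term `a`, if `w` bounds the shuffles of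
`a` and `b`. -/
theorem exists_contraction {a b w : List I} (hb : b ∈ D.B)
    (hw : w.length = a.length + b.length) (hmax : ∀ z, Sh a b z → z ≤ w) :
    ∃ f : H →ₗ[k] k, (∀ y ∈ D.F w, contract f y ∈ D.F a) ∧
      contract f (D.X w) - D.coef w (a, b) • (D.γ (D.deg b) * D.X a) ∈ D.F a := by
  classical
  obtain ⟨f, hγ, hlo, h1⟩ := D.exists_dual_word hb
  refine ⟨f, fun y hy => ?_, ?_⟩
  · have : D.F w ≤ (D.F a).comap (contract f) := D.F_le_iff.2 fun g v hv => by
      rw [Submodule.mem_comap, contract_γ_mul_X]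
      refine Submodule.sum_mem _ fun p hp => ?_
      have hsh := D.sh_of_coef_ne_zero (Finsupp.mem_support_iff.1 hp)
      rcases hsh.lo_or_lo hw hmax hv.le with h | h | ⟨rfl, -⟩
      · exact Submodule.smul_mem _ _ (D.γ_mul_X_mem_F h _)
      · simp [hγ, hlo _ h]
      · exact absurd hv (lt_irrefl _)
    exact this hy
  · have hT := D.contract_γ_mul_X f 1 w
    simp only [map_one, one_mul] at hT
    have hsum : D.coef w (a, b) • (D.γ (D.deg b) * D.X a) =
        (D.coef w).sum fun p c => if p = (a, b) then c • (D.γ (D.deg b) * D.X a) else 0 := by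
      rw [Finsupp.sum_ite_eq']
      split_ifs with h
      · rfl
      · rw [Finsupp.notMem_support_iff.1 h, zero_smul]
    rw [hT, hsum, ← Finsupp.sum_sub]
    refine Submodule.sum_mem _ fun p hp => ?_
    have hsh := D.sh_of_coef_ne_zero (Finsupp.mem_support_iff.1 hp)
    by_cases hp' : p = (a, b)
    · simp [hp', h1]
    · dsimp only
      rw [if_neg hp', sub_zero]
      rcases hsh.lo_or_lo hw hmax le_rfl with h | h | ⟨-, h⟩
      · exact Submodule.smul_mem _ _ (D.γ_mul_X_mem_F h _)
      · simp [hlo _ h]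
      · exact absurd (Prod.ext h.1 h.2) hp'

theorem mem_B_of_coef_ne_zero {a b w : List I} (ha : a ∈ D.B) (hb : b ∈ D.B)
    (hmax : ∀ z, Sh a b z → z ≤ w) (hc : D.coef w (a, b) ≠ 0) : w ∈ D.B := by
  obtain ⟨f, h1, h2⟩ := D.exists_contraction hb (D.sh_of_coef_ne_zero hc).length_eq hmax
  intro hw
  refine ha ?_
  have := sub_mem (h1 _ hw) h2
  rw [sub_sub_cancel, Submodule.smul_mem_iff _ hc] at this
  simpa [γ_inv_mul] using D.γ_mul_mem_F this (D.deg b)⁻¹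

/-- A subalgebra containing the group-like elements which is stable under contractions. -/
structure IsCoideal (U : Subalgebra k H) : Prop where
  γ_mem : ∀ g, D.γ g ∈ U
  contract_mem : ∀ f : H →ₗ[k] k, ∀ u ∈ U, contract f u ∈ U

/-- The irreducible words which are leading words of elements of `U`. -/
def L (U : Subalgebra k H) : Set (List I) := {w | w ∈ D.B ∧ ∃ u ∈ U, D.Lead u w}

variable {D} {U : Subalgebra k H}

theorem IsCoideal.mem_L_of_coef_ne_zero (hU : D.IsCoideal U) {a b w : List I} (ha : a ∈ D.B)
    (hb : b ∈ D.B) (hmax : ∀ z, Sh a b z → z ≤ w) (hc : D.coef w (a, b) ≠ 0) (hw : w ∈ D.L U) :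
    a ∈ D.L U := by
  obtain ⟨f, h1, h2⟩ := D.exists_contraction hb (D.sh_of_coef_ne_zero hc).length_eq hmax
  obtain ⟨u, huU, hu⟩ := hw.2
  refine ⟨ha, (D.coef w (a, b))⁻¹ • (D.γ (D.deg b)⁻¹ * contract f u),
    U.smul_mem (U.mul_mem (hU.γ_mem _) (hU.contract_mem f u huU)) _, ?_⟩
  have h3 := h1 _ hu
  rw [map_sub] at h3
  have h4 := Submodule.smul_mem _ (D.coef w (a, b))⁻¹
    (D.γ_mul_mem_F (add_mem h3 h2) (D.deg b)⁻¹)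
  rwa [sub_add_sub_cancel, mul_sub, mul_smul_comm, γ_inv_mul, smul_sub, inv_smul_smul₀ hc] at h4

theorem IsCoideal.mem_iff (hU : D.IsCoideal U) (he : ∀ b, D.Lead (e b) b)
    (heU : ∀ b : D.B, (b : List I) ∈ D.L U → e b ∈ U) (u : H) :
    u ∈ U ↔ u ∈ Submodule.span k {y | ∃ g, ∃ b : D.B, (b : List I) ∈ D.L U ∧
      y = D.γ g * e b} := by
  classical
  have hle : ∀ y ∈ Submodule.span k {y | ∃ g, ∃ b : D.B, (b : List I) ∈ D.L U ∧
      y = D.γ g * e b}, y ∈ U := fun y hy => by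
    have : Submodule.span k {y | ∃ g, ∃ b : D.B, (b : List I) ∈ D.L U ∧
        y = D.γ g * e b} ≤ Subalgebra.toSubmodule U := by
      rw [Submodule.span_le]
      rintro _ ⟨g, b, hb, rfl⟩
      exact U.mul_mem (hU.γ_mem g) (heU b hb)
    exact this hy
  refine ⟨fun hu => ?_, hle u⟩
  obtain ⟨c, rfl⟩ : ∃ c, Finsupp.linearCombination k (fun p : G × D.B => D.γ p.1 * e p.2) c =
      u := by
    rw [← LinearMap.mem_range, Finsupp.range_linearCombination, D.span_γ_mul he]
    trivial
  set c₁ := c.filter fun p => (p.2 : List I) ∈ D.L U with hc₁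
  set c₂ := c.filter fun p => ¬ (p.2 : List I) ∈ D.L U with hc₂
  have hc : c = c₁ + c₂ := (Finsupp.filter_add_filter_not c _).symm
  have h1 : Finsupp.linearCombination k (fun p => D.γ p.1 * e p.2) c₁ ∈ Submodule.span k
      {y | ∃ g, ∃ b : D.B, (b : List I) ∈ D.L U ∧ y = D.γ g * e b} := by
    rw [Finsupp.linearCombination_apply]
    refine Submodule.sum_mem _ fun p hp => Submodule.smul_mem _ _ (Submodule.subset_span ?_)
    rw [hc₁, Finsupp.support_filter, Finset.mem_filter] at hp
    exact ⟨p.1, p.2, hp.2, rfl⟩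
  suffices h : c₂ = 0 by
    rw [hc, h, add_zero]
    exact h1
  by_contra hne
  obtain ⟨g, b, f, hgb, hlead⟩ := D.exists_lead_contract he hne
  rw [hc, map_add] at hu
  have h2 := U.sub_mem hu (hle _ h1)
  rw [add_sub_cancel_left] at h2
  have hbL : (b : List I) ∈ D.L U :=
    ⟨b.2, _, U.mul_mem (hU.γ_mem _) (hU.contract_mem f _ h2), hlead⟩
  exact hgb (by rw [hc₂]; exact Finsupp.filter_apply_neg _ _ (not_not.2 hbL))

omit [WellFoundedGT I] in
theorem nil_mem_L : [] ∈ D.L U := ⟨D.nil_mem_B, 1, U.one_mem, Lead.one D⟩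

omit [WellFoundedGT I] in
theorem append_mem_L {a b : List I} (ha : a ∈ D.L U) (hb : b ∈ D.L U) (hab : a ++ b ∈ D.B) :
    a ++ b ∈ D.L U := by
  obtain ⟨-, u, hu, hua⟩ := ha
  obtain ⟨-, v, hv, hvb⟩ := hb
  exact ⟨hab, u * v, U.mul_mem hu hv, hua.mul hvb⟩

end CharData

section Words

variable {α : Type*} [LinearOrder α]

theorem LyndonList.flatten_iff {Q : List α → Prop} (hnil : Q [])
    (hQ : ∀ l n v, IsLyndon l → v < l → (Q (lpow l n ++ v) ↔ Q (lpow l n) ∧ Q v))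
    {L : List (List α)} (hL : LyndonList L) :
    Q L.flatten ↔ ∀ l, Q (lpow l (L.count l)) := by
  refine hL.induction (P := fun L => Q L.flatten ↔ ∀ l, Q (lpow l (L.count l))) ?_ ?_
  · simp [hnil, lpow_zero]
  · intro l n L hl _ _ hlt ih
    have hl0 : L.count l = 0 := List.count_eq_zero_of_not_mem fun h => lt_irrefl _ (hlt l h)
    rw [List.flatten_append, ← lpow, hQ l n _ hl (hl.flatten_lt hlt), ih]
    constructor
    · rintro ⟨h1, h2⟩ m
      rw [List.count_append, List.count_replicate]
      by_cases hm : m = l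
      · subst hm
        simpa [hl0]
      · simpa [Ne.symm hm] using h2 m
    · intro h
      refine ⟨by simpa [List.count_append, List.count_replicate, hl0] using h l, fun m => ?_⟩
      by_cases hm : m = l
      · subst hm
        simpa [hl0, lpow_zero] using hnil
      · simpa [List.count_append, List.count_replicate, Ne.symm hm] using h m

theorem LyndonList.eq_of_count_eq {L M : List (List α)} (hL : LyndonList L) (hM : LyndonList M)
    (h : ∀ l, IsLyndon l → L.count l = M.count l) : L = M := by
  refine List.Perm.eq_of_pairwise' hL.2 hM.2 (List.perm_iff_count.2 fun l => ?_)
  by_cases hl : IsLyndon l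
  · exact h l hl
  · rw [List.count_eq_zero_of_not_mem fun h => hl (hL.1 l h),
      List.count_eq_zero_of_not_mem fun h => hl (hM.1 l h)]

end Words

theorem exists_height {P : ℕ → Prop} (hP : ∀ m n, m ≤ n → P n → P m) :
    ∃ h : ℕ∞, ∀ n : ℕ, (n : ℕ∞) < h ↔ P n := by
  classical
  by_cases hall : ∀ n, P n
  · exact ⟨⊤, fun n => by simp [hall n]⟩
  · push Not at hall
    refine ⟨Nat.find hall, fun n => ?_⟩
    rw [Nat.cast_lt, Nat.lt_find_iff]
    exact ⟨fun h => not_not.1 (h n le_rfl), fun h m hm => not_not.2 (hP m n hm h)⟩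

namespace CharData

variable {k H I G : Type*} [Field k] [Ring H] [Bialgebra k H] [Group G]
variable {D : CharData k H I G} [LinearOrder I]

theorem lpow_mem_B_of_le {l : List I} {m n : ℕ} (hmn : m ≤ n) (h : lpow l n ∈ D.B) :
    lpow l m ∈ D.B := by
  obtain ⟨d, rfl⟩ := Nat.exists_eq_add_of_le hmn
  rw [lpow_add] at h
  exact D.left_mem_B h

variable [WellFoundedGT I] {U : Subalgebra k H}

theorem lpow_append_mem_B {l v : List I} (hl : IsLyndon l) (hv : v < l) (n : ℕ) :
    lpow l n ++ v ∈ D.B ↔ lpow l n ∈ D.B ∧ v ∈ D.B :=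
  ⟨fun h => ⟨D.left_mem_B h, D.right_mem_B h⟩, fun h =>
    D.mem_B_of_coef_ne_zero h.1 h.2 (fun _ hz => hl.sh_lpow_le hv n hz)
      (D.coef_lpow_append hl hv n).1⟩

theorem IsCoideal.lpow_append_mem_L (hU : D.IsCoideal U) {l v : List I} (hl : IsLyndon l)
    (hv : v < l) (n : ℕ) : lpow l n ++ v ∈ D.L U ↔ lpow l n ∈ D.L U ∧ v ∈ D.L U := by
  have hc := D.coef_lpow_append hl hv n
  refine ⟨fun h => ?_, fun h => append_mem_L h.1 h.2 ((lpow_append_mem_B hl hv n).2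
    ⟨h.1.1, h.2.1⟩)⟩
  have h1 := D.left_mem_B h.1
  have h2 := D.right_mem_B h.1
  exact ⟨hU.mem_L_of_coef_ne_zero h1 h2 (fun _ hz => hl.sh_lpow_le hv n hz) hc.1 h,
    hU.mem_L_of_coef_ne_zero h2 h1 (fun _ hz => hl.sh_lpow_le hv n hz.symm) hc.2 h⟩

/-- The exponents of a Lyndon word `l` in the irreducible words and in the leading words of `U`:
every exponent is uniquely `i + s * j` below the heights `h false` and `h true`. -/
theorem IsCoideal.exists_exponents (hU : D.IsCoideal U) {l : List I} (hl : IsLyndon l) :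
    ∃ (s : ℕ) (h : Bool → ℕ∞) (c : H), 0 < s ∧ D.Lead c (lpow l s) ∧ (1 < h true → c ∈ U) ∧
      (∀ n, lpow l n ∈ D.B ↔ ∃ i j : ℕ, i < h false ∧ j < h true ∧ i + s * j = n) ∧
      (∀ i j i' j' : ℕ, i < h false → j < h true → i' < h false → j' < h true →
        i + s * j = i' + s * j' → i = i' ∧ j = j') ∧
      (∀ i j : ℕ, i < h false → j < h true → (lpow l (i + s * j) ∈ D.L U ↔ i = 0)) := by
  classical
  by_cases hex : ∃ n, 0 < n ∧ lpow l n ∈ D.L U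
  · obtain ⟨hs, hsL⟩ := Nat.find_spec hex
    have hmin : ∀ n, n < Nat.find hex → lpow l n ∈ D.L U → n = 0 := fun n hn hnL => by
      by_contra h0
      exact Nat.find_min hex hn ⟨by omega, hnL⟩
    set s := Nat.find hex
    obtain ⟨c, hcU, hc⟩ := hsL.2
    obtain ⟨h1, hh1⟩ := exists_height (P := fun n => lpow l (s * n) ∈ D.B) fun m n hmn =>
      lpow_mem_B_of_le (Nat.mul_le_mul_left s hmn)
    have hleft : ∀ m n, lpow l (m + n) ∈ D.L U → D.coef (lpow l (m + n)) (lpow l m, lpow l n) ≠ 0 →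
        lpow l m ∈ D.L U := fun m n h hne =>
      hU.mem_L_of_coef_ne_zero (lpow_mem_B_of_le (by omega) h.1)
        (lpow_mem_B_of_le (by omega) h.1) (fun _ hz => hl.sh_lpow_lpow_le m n hz) hne h
    have hvan : ∀ i, 0 < i → i < s → qbinom (D.chi l (D.deg l)) s i = 0 := fun i hi his => by
      by_contra hne
      obtain ⟨j, hj⟩ := Nat.exists_eq_add_of_le his.le
      rw [hj, ← D.coef_lpow_lpow hl] at hne
      exact hi.ne' (hmin i his (hleft i j (hj ▸ hsL) hne))
    have hcoef : ∀ i j, i < s → D.coef (lpow l (i + s * j)) (lpow l i, lpow l (s * j)) ≠ 0 :=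
      fun i j hi => by
        rw [D.coef_lpow_lpow hl]
        exact qbinom_ne_zero_of_vanishing (D.chi_ne_zero _ _) hvan j hi
    have hB : ∀ i j, i < s → lpow l (s * j) ∈ D.B → lpow l (i + s * j) ∈ D.B := fun i j hi h =>
      D.mem_B_of_coef_ne_zero (lpow_mem_B_of_le hi.le hsL.1) h
        (fun _ hz => hl.sh_lpow_lpow_le _ _ hz) (hcoef i j hi)
    refine ⟨s, fun b => bif b then h1 else s, c, hs, hc, fun _ => hcU, fun n => ?_, ?_, ?_⟩
    · simp only [cond_true, cond_false, Nat.cast_lt, hh1]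
      constructor
      · intro hn
        exact ⟨n % s, n / s, Nat.mod_lt _ hs, lpow_mem_B_of_le (Nat.mul_div_le n s) hn,
          Nat.mod_add_div n s⟩
      · rintro ⟨i, j, hi, hj, rfl⟩
        exact hB i j hi hj
    · simp only [cond_true, cond_false, Nat.cast_lt, hh1]
      intro i j i' j' hi _ hi' _ h
      have hmod := congrArg (· % s) h
      have hdiv := congrArg (· / s) h
      simp only [Nat.add_mul_mod_self_left, Nat.mod_eq_of_lt hi, Nat.mod_eq_of_lt hi'] at hmod
      simp only [Nat.add_mul_div_left _ _ hs, Nat.div_eq_of_lt hi, Nat.div_eq_of_lt hi',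
        zero_add] at hdiv
      exact ⟨hmod, hdiv⟩
    · simp only [cond_true, cond_false, Nat.cast_lt, hh1]
      intro i j hi hj
      refine ⟨fun h => hmin i hi (hleft _ _ h (hcoef i j hi)), ?_⟩
      rintro rfl
      rw [zero_add]
      exact ⟨hj, c ^ j, U.pow_mem hcU j, by rw [lpow_mul]; exact hc.pow j⟩
  · push Not at hex
    obtain ⟨h0, hh0⟩ := exists_height (P := fun n => lpow l n ∈ D.B) fun m n hmn =>
      lpow_mem_B_of_le hmn
    have hlt : ∀ j : ℕ, (j : ℕ∞) < 1 ↔ j = 0 := fun j => by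
      rw [← Nat.cast_one, Nat.cast_lt, Nat.lt_one_iff]
    refine ⟨1, fun b => bif b then 1 else h0, D.X (lpow l 1), one_pos, D.lead_X _,
      fun h => absurd h (lt_irrefl _), fun n => ?_, ?_, ?_⟩
    · simp [hh0, hlt]
    · simp only [cond_true, cond_false, hh0, hlt]
      omega
    · simp only [cond_true, cond_false, hh0, hlt]
      rintro i j hi rfl
      rw [mul_zero, add_zero]
      refine ⟨fun h => ?_, ?_⟩
      · by_contra h0
        exact hex i (by omega) h
      · rintro rfl
        exact nil_mem_L

end CharData

section Index

variable {I : Type*} [LinearOrder I]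

/-- Indices of PBW-generators: a Lyndon word with a mark, larger words coming first. -/
abbrev Idx (I : Type*) [LinearOrder I] := {l : List I // IsLyndon l}ᵒᵈ ×ₗ Bool

namespace Idx

/-- The Lyndon word of an index. -/
def word (p : Idx I) : {l : List I // IsLyndon l} := OrderDual.ofDual (ofLex p).1

/-- The mark of an index. -/
def mark (p : Idx I) : Bool := (ofLex p).2

/-- The index with given word and mark. -/
def mk (l : {l : List I // IsLyndon l}) (b : Bool) : Idx I := toLex (OrderDual.toDual l, b)

@[simp] theorem word_mk (l : {l : List I // IsLyndon l}) (b : Bool) : (mk l b).word = l := rfl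

@[simp] theorem mark_mk (l : {l : List I // IsLyndon l}) (b : Bool) : (mk l b).mark = b := rfl

theorem mk_word_mark (p : Idx I) : mk p.word p.mark = p := rfl

theorem word_le_of_le {p q : Idx I} (h : p ≤ q) : q.word ≤ p.word := by
  rcases Prod.Lex.le_iff.1 h with h | ⟨h, -⟩
  · exact le_of_lt h
  · exact (congrArg OrderDual.ofDual h).ge

end Idx

variable (s : {l : List I // IsLyndon l} → ℕ)

/-- The power of its Lyndon word which an index stands for. -/
def Idx.mult (p : Idx I) : ℕ := bif p.mark then s p.word else 1

/-- The list of Lyndon words of a PBW-monomial. -/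
noncomputable def blocks (f : Idx I →₀ ℕ) : List (List I) :=
  (f.support.sort (· ≤ ·)).flatMap fun p => List.replicate (p.mult s * f p) (p.word : List I)

theorem lyndonList_blocks (f : Idx I →₀ ℕ) : LyndonList (blocks s f) := by
  constructor
  · intro l hl
    obtain ⟨p, -, hp⟩ := List.mem_flatMap.1 hl
    rw [List.eq_of_mem_replicate hp]
    exact p.word.2
  · rw [blocks, List.pairwise_flatMap]
    refine ⟨fun p _ => List.pairwise_replicate.2 (.inr le_rfl),
      (Finset.pairwise_sort f.support (· ≤ ·)).imp fun h x hx y hy => ?_⟩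
    rw [List.eq_of_mem_replicate hx, List.eq_of_mem_replicate hy]
    exact Idx.word_le_of_le h

theorem count_blocks (f : Idx I →₀ ℕ) (l : {l : List I // IsLyndon l}) :
    (blocks s f).count (l : List I) = f (.mk l false) + s l * f (.mk l true) := by
  classical
  have h : (blocks s f).count (l : List I) =
      ∑ p ∈ f.support, if p.word = l then p.mult s * f p else 0 := by
    rw [blocks, List.count_flatMap,
      ((Finset.sort_perm_toList f.support (· ≤ ·)).map _).sum_eq, Finset.sum_map_toList]
    refine Finset.sum_congr rfl fun p _ => ?_
    simp [List.count_replicate, Subtype.ext_iff]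
  have hne : Idx.mk l false ≠ Idx.mk l true := fun h => by
    simpa using congrArg Idx.mark h
  rw [h, Finset.sum_subset (Finset.subset_union_left (s₂ := {Idx.mk l false, Idx.mk l true})),
    ← Finset.sum_subset (Finset.subset_union_right (s₁ := f.support)), Finset.sum_pair hne]
  · simp [Idx.mult]
  · intro p _ hp
    rw [if_neg]
    rintro rfl
    apply hp
    rw [← p.mk_word_mark]
    cases p.mark <;> simp
  · intro p _ hp
    simp [Finsupp.notMem_support_iff.1 hp]

/-- Exponents are determined by their lists of Lyndon words if this holds for each Lyndon word
separately. -/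
theorem blocks_injOn {h : Idx I → ℕ∞}
    (hs : ∀ l (i j i' j' : ℕ), i < h (.mk l false) → j < h (.mk l true) → i' < h (.mk l false) →
      j' < h (.mk l true) → i + s l * j = i' + s l * j' → i = i' ∧ j = j')
    {f f' : Idx I →₀ ℕ} (hf : Restricted h f) (hf' : Restricted h f')
    (he : (blocks s f).flatten = (blocks s f').flatten) : f = f' := by
  have hb := (lyndonList_blocks s f).eq_of_flatten_eq (lyndonList_blocks s f') he
  ext p
  have hl := congrArg (List.count (p.word : List I)) hb
  rw [count_blocks, count_blocks] at hl
  obtain ⟨h0, h1⟩ := hs _ _ _ _ _ (hf _) (hf _) (hf' _) (hf' _) hl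
  rw [← p.mk_word_mark]
  cases p.mark
  exacts [h0, h1]

theorem exists_blocks_eq {h : Idx I → ℕ∞} (hs : ∀ l, 0 < s l) {L : List (List I)}
    (hL : LyndonList L)
    (hex : ∀ l : {l : List I // IsLyndon l}, ∃ i j : ℕ, i < h (.mk l false) ∧ j < h (.mk l true) ∧
      i + s l * j = L.count (l : List I)) :
    ∃ f, Restricted h f ∧ blocks s f = L := by
  classical
  choose i j hi hj hij using hex
  have hfin : (Function.support fun p : Idx I =>
      bif p.mark then j p.word else i p.word).Finite := by
    have : Finite {l : {l : List I // IsLyndon l} // (l : List I) ∈ L} :=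
      Finite.of_injective (β := {l : List I // l ∈ L}) (fun l => ⟨l.1, l.2⟩) fun a b h =>
        Subtype.ext (Subtype.ext (Subtype.mk.inj h))
    refine (Set.finite_range fun q : {l : {l : List I // IsLyndon l} // (l : List I) ∈ L} × Bool =>
      Idx.mk q.1 q.2).subset fun p hp => ?_
    by_cases hpL : (p.word : List I) ∈ L
    · exact ⟨(⟨p.word, hpL⟩, p.mark), rfl⟩
    · have h0 := hij p.word
      rw [List.count_eq_zero_of_not_mem hpL, Nat.add_eq_zero_iff, Nat.mul_eq_zero] at h0
      have := (hs p.word).ne'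
      cases hm : p.mark <;> simp_all
  have hR : Restricted h (Finsupp.ofSupportFinite _ hfin) := fun p => by
    rw [Finsupp.ofSupportFinite_coe, ← p.mk_word_mark]
    cases p.mark
    exacts [hi _, hj _]
  refine ⟨_, hR, (lyndonList_blocks s _).eq_of_count_eq hL fun l hl => ?_⟩
  rw [count_blocks s _ ⟨l, hl⟩, ← hij ⟨l, hl⟩]
  simp [Finsupp.ofSupportFinite_coe]

end Index

namespace CharData

variable {k H I G : Type*} [Field k] [Ring H] [Bialgebra k H] [Group G]
variable {D : CharData k H I G} [LinearOrder I]

theorem Lead.list_prod {V : Type*} {L : List V} {u : V → H} {w : V → List I}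
    (h : ∀ v, D.Lead (u v) (w v)) : D.Lead (L.map u).prod (L.flatMap w) := by
  induction L with
  | nil => exact Lead.one D
  | cons v L ih => simpa using (h v).mul ih

theorem Lead.pbwProd {s : {l : List I // IsLyndon l} → ℕ} {u : Idx I → H}
    (h : ∀ p, D.Lead (u p) (lpow (p.word : List I) (p.mult s))) (f : Idx I →₀ ℕ) :
    D.Lead (pbwProd u f) (blocks s f).flatten := by
  have : (blocks s f).flatten = (f.support.sort (· ≤ ·)).flatMap fun p =>
      lpow (lpow (p.word : List I) (p.mult s)) (f p) := by
    simp only [blocks, List.flatMap, List.flatten_flatten, List.map_map, ← lpow_mul]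
    rfl
  rw [this]
  exact Lead.list_prod fun p => (h p).pow _

variable [WellFoundedGT I] {U : Subalgebra k H}

theorem IsCoideal.exists_pbw (hU : D.IsCoideal U) :
    ∃ (u : Idx I → H) (h : Idx I → ℕ∞) (T : Set (Idx I)), IsPBWBasis k D.γ u h ∧
      ∀ x, x ∈ U ↔ x ∈ Submodule.span k {y | ∃ g f, Restricted h f ∧ ↑f.support ⊆ T ∧
        y = D.γ g * pbwProd u f} := by
  choose s h c hs hc hcU hB hinj hL using
    fun l : {l : List I // IsLyndon l} => hU.exists_exponents l.2
  let u : Idx I → H := fun p => bif p.mark then c p.word else D.X p.word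
  let ht : Idx I → ℕ∞ := fun p => h p.word p.mark
  have hlead : ∀ f, D.Lead (pbwProd u f) (blocks s f).flatten := Lead.pbwProd fun p => by
    cases hm : p.mark
    · simpa [u, hm, Idx.mult, lpow_one] using D.lead_X _
    · simpa [u, hm, Idx.mult] using hc p.word
  have hBL : ∀ L : List (List I), LyndonList L → (L.flatten ∈ D.B ↔
      ∀ l : {l : List I // IsLyndon l}, lpow (l : List I) (L.count (l : List I)) ∈ D.B) :=
    fun L hLL => by
      rw [hLL.flatten_iff (Q := (· ∈ D.B)) D.nil_mem_B fun l n v hl hv => lpow_append_mem_B hl hv n]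
      refine ⟨fun h l => h l, fun h l => ?_⟩
      by_cases hl : IsLyndon l
      · exact h ⟨l, hl⟩
      · rw [List.count_eq_zero_of_not_mem fun h => hl (hLL.1 l h)]
        exact D.nil_mem_B
  have hmem : ∀ f, Restricted ht f → (blocks s f).flatten ∈ D.B := fun f hf =>
    (hBL _ (lyndonList_blocks s f)).2 fun l => by
      rw [count_blocks]
      exact (hB l _).2 ⟨_, _, hf (.mk l false), hf (.mk l true), rfl⟩
  let φ : {f : Idx I →₀ ℕ // Restricted ht f} → D.B := fun f => ⟨_, hmem f.1 f.2⟩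
  have hφ : Function.Bijective φ := by
    refine ⟨fun f f' hff => Subtype.ext (blocks_injOn s (fun l i j i' j' => hinj l i j i' j')
      f.2 f'.2 (congrArg Subtype.val hff)), fun b => ?_⟩
    obtain ⟨L, hLL, hb⟩ := exists_lyndonList (b : List I)
    obtain ⟨f, hf, rfl⟩ := exists_blocks_eq s (h := ht) hs hLL fun l =>
      (hB l _).1 ((hBL L hLL).1 (hb ▸ b.2) l)
    exact ⟨⟨f, hf⟩, Subtype.ext hb⟩
  let e : D.B → H := fun b => pbwProd u ((Equiv.ofBijective φ hφ).symm b).1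
  have heφ : ∀ f, e (φ f) = pbwProd u f.1 := fun f => by
    simp only [e]
    rw [← Equiv.ofBijective_apply φ hφ, Equiv.symm_apply_apply]
  have he : ∀ b, D.Lead (e b) b := fun b => by
    obtain ⟨f, rfl⟩ := hφ.2 b
    rw [heφ]
    exact hlead f.1
  have hfam : pbwFam D.γ u ht = (fun p : G × D.B => D.γ p.1 * e p.2) ∘
      (Equiv.refl G).prodCongr (Equiv.ofBijective φ hφ) := by
    funext p
    simp [pbwFam, heφ]
  have hφL : ∀ f, (φ f : List I) ∈ D.L U ↔ ↑f.1.support ⊆ {p : Idx I | p.mark = true} := by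
    intro f
    have hQ := (lyndonList_blocks s f.1).flatten_iff (Q := (· ∈ D.L U)) nil_mem_L
      fun l n v hl hv => hU.lpow_append_mem_L hl hv n
    refine hQ.trans ⟨fun h p hp => ?_, fun h l => ?_⟩
    · by_contra hm
      have h' := h (p.word : List I)
      rw [count_blocks, hL p.word _ _ (f.2 (.mk p.word false)) (f.2 (.mk p.word true))] at h'
      refine Finsupp.mem_support_iff.1 (Finset.mem_coe.1 hp) ?_
      rw [← p.mk_word_mark, show p.mark = false by simpa using hm]
      exact h'
    · by_cases hl : IsLyndon l
      · rw [count_blocks s f.1 ⟨l, hl⟩,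
          hL ⟨l, hl⟩ _ _ (f.2 (.mk ⟨l, hl⟩ false)) (f.2 (.mk ⟨l, hl⟩ true))]
        by_contra hne
        simpa using h (Finset.mem_coe.2 (Finsupp.mem_support_iff.2 hne))
      · rw [List.count_eq_zero_of_not_mem fun h => hl ((lyndonList_blocks s f.1).1 l h)]
        exact nil_mem_L
  refine ⟨u, ht, {p | p.mark = true}, ⟨?_, ?_⟩, fun x => ?_⟩
  · rw [hfam]
    exact (D.linearIndependent_γ_mul he).comp _ (Equiv.injective _)
  · rw [hfam, Set.range_comp, (Equiv.surjective _).range_eq, Set.image_univ]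
    exact D.span_γ_mul he
  · rw [hU.mem_iff he]
    · suffices h : {y | ∃ g, ∃ b : D.B, (b : List I) ∈ D.L U ∧ y = D.γ g * e b} =
          {y | ∃ g f, Restricted ht f ∧ ↑f.support ⊆ {p : Idx I | p.mark = true} ∧
            y = D.γ g * pbwProd u f} by rw [h]
      ext y
      constructor
      · rintro ⟨g, b, hb, rfl⟩
        obtain ⟨f, rfl⟩ := hφ.2 b
        exact ⟨g, f.1, f.2, (hφL f).1 hb, by rw [heφ]⟩
      · rintro ⟨g, f, hf, hT, rfl⟩
        exact ⟨g, φ ⟨f, hf⟩, (hφL _).2 hT, by rw [heφ]⟩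
    · intro b hb
      obtain ⟨f, rfl⟩ := hφ.2 b
      rw [heφ]
      refine U.toSubmonoid.list_prod_mem fun y hy => ?_
      obtain ⟨p, hp, rfl⟩ := List.mem_map.1 hy
      rw [Finset.mem_sort] at hp
      have hm : p.mark = true := (hφL f).1 hb hp
      refine U.pow_mem ?_ _
      have h1 : (1 : ℕ∞) < h p.word true := by
        have := f.2 p
        simp only [ht, hm] at this
        refine lt_of_le_of_lt ?_ this
        exact_mod_cast Nat.one_le_iff_ne_zero.2 (Finsupp.mem_support_iff.1 hp)
      simpa [u, hm] using hcU _ h1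

end CharData

section Transport

variable {k S J W : Type*} [Field k] [Ring S] [Algebra k S] [LinearOrder W]
variable {a : J → S} {emb : W → S} {h : W → ℕ∞}

theorem _root_.IsPBWBasis.height_pos [Nontrivial S] (hP : IsPBWBasis k a emb h) (w : W) :
    0 < h w := by
  obtain ⟨p⟩ : Nonempty (J × {f : W →₀ ℕ // Restricted h f}) := by
    by_contra hne
    rw [not_nonempty_iff] at hne
    have := hP.2
    rw [Set.range_eq_empty, Submodule.span_empty] at this
    exact bot_ne_top this
  exact lt_of_le_of_lt zero_le (p.2.2 w)

theorem _root_.IsPBWBasis.injOn [Nontrivial S] [Nonempty J] (hP : IsPBWBasis k a emb h) :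
    Set.InjOn emb {w | 1 < h w} := by
  obtain ⟨j⟩ := ‹Nonempty J›
  have hR : ∀ w, 1 < h w → Restricted h (Finsupp.single w 1) := fun w hw v => by
    classical
    rw [Finsupp.single_apply]
    split_ifs with hv
    · simpa [← hv] using hw
    · simpa using hP.height_pos v
  intro v hv w hw he
  have h1 : ∀ w, pbwProd emb (Finsupp.single w 1) = emb w := fun w => by
    rw [pbwProd, Finsupp.support_single _ one_ne_zero]
    simp
  have : pbwFam a emb h (j, ⟨_, hR v hv⟩) = pbwFam a emb h (j, ⟨_, hR w hw⟩) := by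
    simp only [pbwFam, h1, he]
  exact (Finsupp.single_left_inj one_ne_zero).1
    (congrArg (fun p => p.2.1) (hP.1.injective this))

theorem pbwProd_embDomain {M V : Type*} [Monoid M] [LinearOrder V] {emb : W → M} (j : V ↪o W)
    (f : V →₀ ℕ) :
    pbwProd emb (f.embDomain j.toEmbedding) = pbwProd (fun v => emb (j v)) f := by
  have : (f.support.map j.toEmbedding).sort (· ≤ ·) = (f.support.sort (· ≤ ·)).map j :=
    (Finset.map_sort j.toEmbedding f.support (· ≤ ·) (· ≤ ·)
      fun a _ b _ => j.le_iff_le.symm).symm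
  rw [pbwProd, pbwProd, Finsupp.support_embDomain, this, List.map_map]
  refine congrArg List.prod (List.map_congr_left fun v _ => ?_)
  exact congrArg (emb (j v) ^ ·) (Finsupp.embDomain_apply_self j.toEmbedding f v)

/-- Generators of height one may be discarded. -/
noncomputable def restrictedEquiv {V : Type*} [LinearOrder V] (j : V ↪o W)
    (hpos : ∀ w, 0 < h w) (hj : {w | 1 < h w} ⊆ Set.range j) :
    {f : V →₀ ℕ // Restricted (fun v => h (j v)) f} ≃ {f : W →₀ ℕ // Restricted h f} :=
  Equiv.ofBijective (fun f => ⟨f.1.embDomain j.toEmbedding, fun w => by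
      by_cases hw : w ∈ Set.range j
      · obtain ⟨v, rfl⟩ := hw
        exact (Finsupp.embDomain_apply_self j.toEmbedding f.1 v).symm ▸ f.2 v
      · rw [Finsupp.embDomain_of_notMem_range _ _ _ hw]
        exact hpos w⟩) <| by
    refine ⟨fun f g hfg => Subtype.ext (Finsupp.embDomain_injective j.toEmbedding
      (congrArg Subtype.val hfg)), fun g => ?_⟩
    have hg : ↑g.1.support ⊆ Set.range j.toEmbedding := fun w hw => hj <| by
      refine lt_of_le_of_lt ?_ (g.2 w)
      exact_mod_cast Nat.one_le_iff_ne_zero.2 (Finsupp.mem_support_iff.1 hw)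
    have he := Finsupp.embDomain_comapDomain (f := j.toEmbedding) hg
    refine ⟨⟨g.1.comapDomain j.toEmbedding j.injective.injOn, fun v => ?_⟩, Subtype.ext he⟩
    exact g.2 (j v)

theorem pbwProd_restrictedEquiv {V : Type*} [LinearOrder V] (j : V ↪o W)
    (hpos : ∀ w, 0 < h w) (hj : {w | 1 < h w} ⊆ Set.range j)
    (f : {f : V →₀ ℕ // Restricted (fun v => h (j v)) f}) :
    pbwProd emb (restrictedEquiv j hpos hj f).1 = pbwProd (fun v => emb (j v)) f.1 :=
  pbwProd_embDomain j f.1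

/-- An indexed PBW-basis yields a PBW-basis whose generators are elements of the algebra. -/
theorem exists_set_of_isPBWBasis [Nontrivial S] [Nonempty J] (hP : IsPBWBasis k a emb h)
    (T : Set W) :
    ∃ (Vs : Set S) (li : LinearOrder Vs) (h' : Vs → ℕ∞) (T' : Set Vs),
      @IsPBWBasis k S J Vs _ _ _ li a (fun v => v.1) h' ∧
      {y | ∃ j f, Restricted h f ∧ ↑f.support ⊆ T ∧ y = a j * pbwProd emb f} =
        {y | ∃ (j : J) (f : Vs →₀ ℕ), Restricted h' f ∧ ↑f.support ⊆ T' ∧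
          y = a j * @pbwProd S Vs _ li (fun v => v.1) f} := by
  let e := Equiv.Set.imageOfInjOn emb _ hP.injOn
  let li : LinearOrder (emb '' {w | 1 < h w} : Set S) :=
    LinearOrder.lift' e.symm e.symm.injective
  let j : (emb '' {w | 1 < h w} : Set S) ↪o W :=
    ⟨e.symm.toEmbedding.trans (Function.Embedding.subtype _), Iff.rfl⟩
  have hj : {w | 1 < h w} ⊆ Set.range j := fun w hw =>
    ⟨e ⟨w, hw⟩, congrArg Subtype.val (e.symm_apply_apply ⟨w, hw⟩)⟩
  have hemb : (fun v : (emb '' {w | 1 < h w} : Set S) => v.1) = fun v => emb (j v) :=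
    funext fun v => congrArg Subtype.val (e.apply_symm_apply v).symm
  let E := restrictedEquiv j hP.height_pos hj
  have hE : ∀ f, pbwProd emb (E f).1 = pbwProd (fun v => emb (j v)) f.1 :=
    pbwProd_restrictedEquiv j hP.height_pos hj
  have hfam : pbwFam a (fun v => emb (j v)) (fun v => h (j v)) =
      pbwFam a emb h ∘ (Equiv.refl J).prodCongr E :=
    funext fun p => congrArg (a p.1 * ·) (hE p.2).symm
  refine ⟨_, li, fun v => h (j v), j ⁻¹' T, ?_, ?_⟩
  · rw [hemb, IsPBWBasis, hfam, Set.range_comp, (Equiv.surjective _).range_eq, Set.image_univ]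
    exact ⟨hP.1.comp _ (Equiv.injective _), hP.2⟩
  · rw [hemb]
    have hT : ∀ f, ↑(E f).1.support ⊆ T ↔ ↑f.1.support ⊆ j ⁻¹' T := fun f => by
      change ↑(f.1.embDomain j.toEmbedding).support ⊆ T ↔ _
      rw [Finsupp.support_embDomain, Finset.coe_map, Set.image_subset_iff]
      rfl
    ext y
    constructor
    · rintro ⟨i, f, hf, hfT, rfl⟩
      obtain ⟨g, hg⟩ := E.surjective ⟨f, hf⟩
      obtain rfl : (E g).1 = f := congrArg Subtype.val hg
      exact ⟨i, g.1, g.2, (hT g).1 hfT, by rw [hE]⟩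
    · rintro ⟨i, f, hf, hfT, rfl⟩
      exact ⟨i, (E ⟨f, hf⟩).1, (E ⟨f, hf⟩).2, (hT ⟨f, hf⟩).2 hfT, by rw [hE]⟩

theorem _root_.IsPBWBasis.reindex {J' : Type*} (hP : IsPBWBasis k a emb h) (σ : J' ≃ J) :
    IsPBWBasis k (a ∘ σ) emb h := by
  have : pbwFam (a ∘ σ) emb h = pbwFam a emb h ∘ σ.prodCongr (Equiv.refl _) := rfl
  rw [IsPBWBasis, this, Set.range_comp, (Equiv.surjective _).range_eq, Set.image_univ]
  exact ⟨hP.1.comp _ (Equiv.injective _), hP.2⟩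

end Transport

section GroupLike

variable {k H : Type*} [Field k] [Ring H] [HopfAlgebra k H]

theorem isGrpLike_iff {g : H} : IsGrpLike k g ↔ IsGroupLikeElem k g :=
  ⟨fun h => ⟨h.1, h.2⟩, fun h => ⟨h.1, h.2⟩⟩

theorem isGrpLike_val (g : GroupLike k H) : IsGrpLike k g.val :=
  isGrpLike_iff.2 g.isGroupLikeElem_val

/-- The group-like elements as a type of elements of the Hopf algebra. -/
def groupLikeEquiv : {g : H // IsGrpLike k g} ≃ GroupLike k H where
  toFun g := ⟨g.1, isGrpLike_iff.1 g.2⟩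
  invFun g := ⟨g.val, isGrpLike_val g⟩
  left_inv _ := rfl
  right_inv _ := rfl

theorem isUnit_groupLike (g : GroupLike k H) : IsUnit g.val :=
  (Group.isUnit g).map (GroupLike.valMonoidHom k H)

/-- The character by which group-like elements act on a nonzero semi-invariant. -/
def semiInvariantChar {s : H} (hs : s ≠ 0) {χ : {g : H // IsGrpLike k g} → k}
    (hsemi : ∀ g : {g : H // IsGrpLike k g}, s * g.1 = χ g • (g.1 * s)) : GroupLike k H →* k where
  toFun g := χ (groupLikeEquiv.symm g)
  map_one' := by
    have h := hsemi (groupLikeEquiv.symm 1)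
    have h1 : (groupLikeEquiv.symm (1 : GroupLike k H)).1 = 1 := rfl
    rw [h1, mul_one, one_mul] at h
    exact smul_left_injective k hs ((one_smul k s).trans h).symm
  map_mul' g g' := by
    have h : ∀ g : GroupLike k H, s * g.val = χ (groupLikeEquiv.symm g) • (g.val * s) :=
      fun g => hsemi (groupLikeEquiv.symm g)
    have hne : (g * g').val * s ≠ 0 := fun h0 => hs ((isUnit_groupLike _).mul_right_eq_zero.1 h0)
    refine smul_left_injective k hne (Eq.trans (h (g * g')).symm ?_)
    have hm : (g * g').val = g.val * g'.val := rfl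
    change _ = (_ * _) • _
    rw [hm, ← mul_assoc, h, smul_mul_assoc, mul_assoc, h, mul_smul_comm, smul_smul, mul_assoc]

end GroupLike

end CharHopf

open CharHopf

/-- **Main theorem.**  Let `H` be a character Hopf algebra: the group `G` of group-like
elements is commutative and `H` is generated over `k[G]` by skew-primitive
semi-invariants `s i`.  Then every right coideal subalgebra `U ⊇ k[G]` of `H` has a
PBW-basis over `k[G]` which can be extended to a PBW-basis of `H` over `k[G]`: there
are PBW-generators `Vs ⊆ H` of `H` over `k[G]` (the `a_j` being the group-like
elements) and a subset `T ⊆ Vs` such that an element of `H` lies in `U` if and only if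
it is a `k`-linear combination of monotone restricted products `g·v₁^{n₁}⋯v_k^{n_k}`
involving only generators from `T`; in particular `T` is a set of PBW-generators of
`U` over `k[G]`. -/
theorem right_coideal_subalgebra_pbw {k H I : Type*} [Field k] [Ring H]
    [HopfAlgebra k H]
    (s gi : I → H) (χ : I → {g : H // IsGrpLike k g} → k)
    (hgi : ∀ i, IsGrpLike k (gi i))
    (hcomm : ∀ g g' : H, IsGrpLike k g → IsGrpLike k g' → g * g' = g' * g)
    (hskew : ∀ i, Coalgebra.comul (R := k) (s i) = s i ⊗ₜ[k] 1 + gi i ⊗ₜ[k] s i)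
    (hsemi : ∀ i (g : {g : H // IsGrpLike k g}), s i * g.1 = χ i g • (g.1 * s i))
    (hgen : Algebra.adjoin k ({g | IsGrpLike k g} ∪ Set.range s) = ⊤)
    (U : Subalgebra k H)
    (hUG : {g | IsGrpLike k g} ⊆ (U : Set H))
    (hUcoideal : ∀ u ∈ U, Coalgebra.comul (R := k) u ∈
      tsub k (Subalgebra.toSubmodule U) (⊤ : Submodule k H)) :
    ∃ (Vs : Set H) (li : LinearOrder Vs) (h : Vs → ℕ∞) (T : Set Vs),
      @IsPBWBasis k H {g : H // IsGrpLike k g} Vs _ _ _ li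
        (fun g => g.1) (fun v => v.1) h ∧
      ∀ x : H, x ∈ U ↔ x ∈ Submodule.span k
        {y | ∃ (g : H) (f : Vs →₀ ℕ), IsGrpLike k g ∧ Restricted h f ∧
          ↑f.support ⊆ T ∧ y = g * @pbwProd H Vs _ li (fun v => v.1) f} := by
  have : Nontrivial H := ⟨1, 0, fun h => by simpa using congrArg (Coalgebra.counit (R := k)) h⟩
  obtain ⟨_, _⟩ := exists_wellFoundedLT (α := {i // s i ≠ 0})
  let D : CharData k H {i // s i ≠ 0}ᵒᵈ (GroupLike k H) :=
    { γ := GroupLike.valMonoidHom k H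
      x := fun i => s (OrderDual.ofDual i).1
      d := fun i => groupLikeEquiv ⟨_, hgi (OrderDual.ofDual i).1⟩
      χ := fun i => semiInvariantChar (OrderDual.ofDual i).2 (hsemi (OrderDual.ofDual i).1)
      comul_γ := fun g => (isGrpLike_val g).2
      comul_x := fun i => hskew _
      x_mul_γ := fun i g => hsemi _ (groupLikeEquiv.symm g)
      linearIndependent_γ := linearIndep_groupLikeVal
      adjoin_eq_top := by
        rw [eq_top_iff, ← hgen, Algebra.adjoin_le_iff]
        rintro y (hy | ⟨i, rfl⟩)
        · exact Algebra.subset_adjoin (.inl ⟨groupLikeEquiv ⟨y, hy⟩, rfl⟩)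
        · by_cases hi : s i = 0
          · rw [hi]
            exact zero_mem _
          · exact Algebra.subset_adjoin (.inr ⟨OrderDual.toDual ⟨i, hi⟩, rfl⟩) }
  have hU : D.IsCoideal U :=
    { γ_mem := fun g => hUG (isGrpLike_val g)
      contract_mem := fun f u hu => by
        have hle : tsub k (Subalgebra.toSubmodule U) (⊤ : Submodule k H) ≤
            (Subalgebra.toSubmodule U).comap
              ((TensorProduct.rid k H).toLinearMap ∘ₗ f.lTensor H) := by
          rw [tsub, Submodule.span_le]
          rintro _ ⟨a, ha, b, -, rfl⟩
          simpa using U.smul_mem ha (f b)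
        exact hle (hUcoideal u hu) }
  obtain ⟨emb, h, T, hP, hT⟩ := hU.exists_pbw
  obtain ⟨Vs, li, h', T', hP', he⟩ := exists_set_of_isPBWBasis hP T
  refine ⟨Vs, li, h', T', hP'.reindex groupLikeEquiv, fun x => (hT x).trans ?_⟩
  suffices heq : {y | ∃ g f, Restricted h f ∧ ↑f.support ⊆ T ∧ y = D.γ g * pbwProd emb f} =
      {y | ∃ (g : H) (f : Vs →₀ ℕ), IsGrpLike k g ∧ Restricted h' f ∧
        ↑f.support ⊆ T' ∧ y = g * @pbwProd H Vs _ li (fun v => v.1) f} by rw [heq]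
  rw [he]
  ext y
  constructor
  · rintro ⟨g, f, hf, hfT, rfl⟩
    exact ⟨g.val, f, isGrpLike_val g, hf, hfT, rfl⟩
  · rintro ⟨g, f, hg, hf, hfT, rfl⟩
    exact ⟨groupLikeEquiv ⟨g, hg⟩, f, hf, hfT, rfl⟩
end
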